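/- There exists a finite set Ω₀ of seven L-sentences, each an instance of the Replacement scheme, and a function F mapping L-formulas to L-formulas, such that: for every countable transitive set M with (M,∈) ⊨ Z ∪ Ω₀ and every set Φ of L-formulas with (M,∈) ⊨ {Replacement(F(φ)) : φ ∈ Φ}, there exists a countable transitive set N with M ⊆ N, M ≠ N, containing exactly the same ordinals as M, such that (N,∈) ⊨ Z ∪ {Replacement(φ) : φ ∈ Φ}, and if (M,∈) ⊨ AC then (N,∈) ⊨ AC. -/

import Mathlib

namespace CtmForcing

open FirstOrder FirstOrder.Language

/-! ### The first-order language of set theory -/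

/-- The relation symbols of the language of set theory: a single binary relation `∈`. -/
inductive memRel : ℕ → Type
  | mem : memRel 2

/-- The first-order language `L` of set theory, with a single binary relation symbol `∈`. -/
def SetLang : Language := ⟨fun _ => Empty, memRel⟩

/-- The membership relation symbol. -/
abbrev memSymb : SetLang.Relations 2 := .mem

/-- `L`-formulas (with no free "unbounded" variables) whose free variables are among
`v₀, …, v_{n-1}`. -/
abbrev BF (n : ℕ) := SetLang.BoundedFormula Empty n

/-- The atomic formula `vᵢ ∈ vⱼ`. -/
def memf {n : ℕ} (i j : Fin n) : BF n :=
  memSymb.boundedFormula₂ (Term.var (Sum.inr i)) (Term.var (Sum.inr j))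

/-- The atomic formula `vᵢ = vⱼ`. -/
def eqf {n : ℕ} (i j : Fin n) : BF n :=
  Term.bdEqual (Term.var (Sum.inr i)) (Term.var (Sum.inr j))

/-- Rename the free variables of a formula along `f`. -/
def reindex {m k : ℕ} (f : Fin m → Fin k) (φ : BF m) : BF k :=
  (BoundedFormula.relabel (Sum.map id f) φ.toFormula : SetLang.BoundedFormula Empty (k + 0))

/-- Conjunction. -/
def andF {n : ℕ} (φ ψ : BF n) : BF n := (φ.imp ψ.not).not

/-- Disjunction. -/
def orF {n : ℕ} (φ ψ : BF n) : BF n := (φ.not).imp ψ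

/-- Biimplication. -/
def iffF {n : ℕ} (φ ψ : BF n) : BF n := andF (φ.imp ψ) (ψ.imp φ)

/-! ### Basic set-theoretic formulas -/

/-- `v₀ ⊆ v₁`. -/
def subF : BF 2 := ((memf 2 0).imp (memf 2 1)).all

/-- `v₀ = ∅`. -/
def emptyF : BF 1 := ((memf 1 0).not).all

/-- `v₂ = {v₀, v₁}`. -/
def pairSetF : BF 3 := (iffF (memf 3 2) (orF (eqf 3 0) (eqf 3 1))).all

/-- `v₁ = {v₀}`. -/
def singF : BF 2 := reindex ![0, 0, 1] pairSetF

/-- `v₂ = ⟨v₀, v₁⟩` (Kuratowski ordered pair). -/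
def opF : BF 3 :=
  (iffF (memf 3 2) (orF (reindex ![0, 3] singF) (reindex ![0, 1, 3] pairSetF))).all

/-- `v₁ = v₀ ∪ {v₀}`. -/
def succF : BF 2 := (iffF (memf 2 1) (orF (memf 2 0) (eqf 2 0))).all

/-- `v₀` is transitive. -/
def transF : BF 1 := ((memf 1 0).imp (reindex ![1, 0] subF)).all

/-- `v₀` is an ordinal (a transitive set of transitive sets). -/
def ordF : BF 1 := andF transF (((memf 1 0).imp (reindex ![1] transF)).all)

/-- `⟨v₀, v₁⟩ ∈ v₂`. -/
def relMemF : BF 3 := (andF (reindex ![0, 1, 3] opF) (memf 3 2)).ex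

/-- `v₂` is a function with domain `v₀` mapping onto `v₁` (a surjection from `v₀` onto `v₁`). -/
def isFuncF : BF 3 :=
  andF
    (andF
      -- v₂ ⊆ v₀ × v₁
      (((memf 3 2).imp
        (((andF (andF (memf 4 0) (memf 5 1)) (reindex ![4, 5, 3] opF)).ex).ex)).all)
      -- total on v₀
      (((memf 3 0).imp ((andF (memf 4 1) (reindex ![3, 4, 2] relMemF)).ex)).all))
    (andF
      -- functional
      ((((andF (reindex ![3, 4, 2] relMemF) (reindex ![3, 5, 2] relMemF)).imp
          (eqf 4 5)).all).all.all)
      -- onto v₁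
      (((memf 3 1).imp ((andF (memf 4 0) (reindex ![4, 3, 2] relMemF)).ex)).all))

/-- `v₂` is injective (as a set of ordered pairs). -/
def injF : BF 3 :=
  ((((andF (reindex ![3, 5, 2] relMemF) (reindex ![4, 5, 2] relMemF)).imp
      (eqf 3 4)).all).all).all

/-- `v₂` is a bijection from `v₀` onto `v₁`. -/
def bijF : BF 3 := andF isFuncF injF

/-! ### The axioms of set theory as `L`-sentences -/

/-- Extensionality. -/
def extAx : SetLang.Sentence :=
  ((((andF subF (reindex ![1, 0] subF)).imp (eqf 0 1)).all).all : BF 0)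

/-- Foundation. -/
def foundAx : SetLang.Sentence :=
  (((((memf 1 0).ex).imp
    ((andF (memf 1 0) (((memf 2 0).imp ((memf 2 1).not)).all)).ex)).all) : BF 0)

/-- Pairing. -/
def pairAx : SetLang.Sentence := (((pairSetF.ex).all).all : BF 0)

/-- Union. -/
def unionAx : SetLang.Sentence :=
  (((((iffF (memf 2 1) ((andF (memf 3 0) (memf 2 3)).ex)).all).ex).all : BF 0))

/-- Powerset. -/
def powF : BF 2 := (iffF (memf 2 1) (reindex ![2, 0] subF)).all

/-- Powerset axiom. -/
def powAx : SetLang.Sentence := (((powF.ex).all) : BF 0)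

/-- Infinity. -/
def infAx : SetLang.Sentence :=
  (((andF ((andF (memf 1 0) (reindex ![1] emptyF)).ex)
    (((memf 1 0).imp ((andF (memf 2 0) (reindex ![1, 2] succF)).ex)).all)).ex) : BF 0)

/-- The instance of the Separation scheme given by `φ`, whose free variables are among
`v₀, …, vₙ`: the parameters are `v₀, …, v_{n-1}` and the tested element is `vₙ`.  It is the
universal closure of `∀A ∃B ∀x (x ∈ B ↔ x ∈ A ∧ φ(params, x))`. -/
def sepAx {n : ℕ} (φ : BF (n + 1)) : SetLang.Sentence :=
  -- context `n+3`: parameters `0,…,n-1`, `A = n`, `B = n+1`, `x = n+2`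
  let A : Fin (n + 3) := ⟨n, by omega⟩
  let B : Fin (n + 3) := ⟨n + 1, by omega⟩
  let x : Fin (n + 3) := ⟨n + 2, by omega⟩
  let φ' : BF (n + 3) := reindex (fun i => if h : (i : ℕ) < n then ⟨i, by omega⟩ else x) φ
  ((((iffF (memf x B) (andF (memf x A) φ')).all).ex).all).alls

/-- The instance of the Replacement scheme given by `φ`, whose free variables are among
`v₀, …, v_{n+1}`: the parameters are `v₀, …, v_{n-1}`, the argument is `x = vₙ`, and the
value is `y = v_{n+1}`.  It is the universal closure of
`∀A [(∀x∈A ∀y ∀y' (φ(x,y) ∧ φ(x,y') → y = y')) → ∃B ∀y (y ∈ B ↔ ∃x∈A φ(x,y))]`. -/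
def replAx {n : ℕ} (φ : BF (n + 2)) : SetLang.Sentence :=
  -- functionality context `n+4`: parameters, `A = n`, `x = n+1`, `y = n+2`, `y' = n+3`
  let A : Fin (n + 4) := ⟨n, by omega⟩
  let x : Fin (n + 4) := ⟨n + 1, by omega⟩
  let y : Fin (n + 4) := ⟨n + 2, by omega⟩
  let y' : Fin (n + 4) := ⟨n + 3, by omega⟩
  let φ₁ : BF (n + 4) :=
    reindex (fun i => if h : (i : ℕ) < n then ⟨i, by omega⟩ else if (i : ℕ) = n then x else y) φ
  let φ₂ : BF (n + 4) :=
    reindex (fun i => if h : (i : ℕ) < n then ⟨i, by omega⟩ else if (i : ℕ) = n then x else y') φ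
  let funcl : BF (n + 1) :=
    ((((andF (memf x A) (andF φ₁ φ₂)).imp (eqf y y')).all).all).all
  -- image context `n+4`: parameters, `A = n`, `B = n+1`, `y = n+2`, `x = n+3`
  let xi : Fin (n + 4) := ⟨n + 3, by omega⟩
  let yi : Fin (n + 4) := ⟨n + 2, by omega⟩
  let B3 : Fin (n + 3) := ⟨n + 1, by omega⟩
  let y3 : Fin (n + 3) := ⟨n + 2, by omega⟩
  let φ₃ : BF (n + 4) :=
    reindex (fun i => if h : (i : ℕ) < n then ⟨i, by omega⟩ else if (i : ℕ) = n then xi else yi) φ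
  let image : BF (n + 1) :=
    (((iffF (memf y3 B3) ((andF (memf xi A) φ₃).ex)).all).ex)
  ((funcl.imp image).all).alls

/-- The Axiom of Choice: every set is the surjective image of an ordinal. -/
def acAx : SetLang.Sentence :=
  ((((andF (reindex ![1] ordF) (reindex ![1, 0, 2] isFuncF)).ex).ex).all : BF 0)

/-- `v₀ = ω`: `v₀` is an ordinal containing `∅`, closed under successors, each of whose
elements is `∅` or a successor. -/
def omegaF : BF 1 :=
  andF (andF ordF ((andF (memf 1 0) (reindex ![1] emptyF)).ex))
    (andF (((memf 1 0).imp ((andF (memf 2 0) (reindex ![1, 2] succF)).ex)).all)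
      (((memf 1 0).imp
        (orF (reindex ![1] emptyF) ((andF (memf 2 1) (reindex ![2, 1] succF)).ex))).all))

/-- Given `v₀ = ω`, `v₁ = ℵ₁`: `v₁` is an ordinal, there is no surjection from `ω` onto `v₁`,
and every element of `v₁` is empty or a surjective image of `ω`. -/
def alephOneF : BF 2 :=
  andF (andF (reindex ![1] ordF) (((reindex ![0, 1, 2] isFuncF).ex).not))
    (((memf 2 1).imp (orF (reindex ![2] emptyF) ((reindex ![0, 2, 3] isFuncF).ex))).all)

/-- The Continuum Hypothesis `ℵ₁ = 2^ℵ₀`: there is a bijection between `𝒫(ω)` and `ℵ₁`. -/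
def chSent : SetLang.Sentence :=
  (((((andF (andF (reindex ![0] omegaF) (reindex ![0, 1] powF))
      (andF (reindex ![0, 2] alephOneF) (reindex ![1, 2, 3] bijF))).ex).ex).ex).ex : BF 0)

/-! ### The theories `Z`, `ZF`, `ZC`, `ZFC` -/

/-- The finitely many non-scheme axioms of `ZF`. -/
def zfFin : SetLang.Theory := {extAx, foundAx, pairAx, unionAx, powAx, infAx}

/-- All instances of the Separation scheme. -/
def sepScheme : SetLang.Theory := Set.range fun p : Σ n, BF (n + 1) => sepAx p.2

/-- All instances of the Replacement scheme. -/
def replScheme : SetLang.Theory := Set.range fun p : Σ n, BF (n + 2) => replAx p.2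

/-- Zermelo set theory. -/
def Z : SetLang.Theory := zfFin ∪ sepScheme

/-- Zermelo–Fraenkel set theory. -/
def ZF : SetLang.Theory := Z ∪ replScheme

/-- Zermelo set theory with Choice. -/
def ZC : SetLang.Theory := Z ∪ {acAx}

/-- Zermelo–Fraenkel set theory with Choice. -/
def ZFC : SetLang.Theory := ZF ∪ {acAx}

/-! ### Satisfaction in a set with the true membership relation -/

/-- The `L`-structure on (the elements of) a `ZFSet` `M`, with `∈` interpreted as true
membership. -/
def zfStruct (M : ZFSet) : SetLang.Structure {x : ZFSet // x ∈ M} where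
  funMap := fun f _ => f.elim
  RelMap | .mem => fun v => ((v 0 : {x : ZFSet // x ∈ M}) : ZFSet) ∈ ((v 1 : {x : ZFSet // x ∈ M}) : ZFSet)

/-- `(M, ∈) ⊨ T`: the structure on `M` with true membership satisfies every sentence of `T`. -/
def ZModels (M : ZFSet) (T : SetLang.Theory) : Prop :=
  ∀ φ ∈ T, letI := zfStruct M; Sentence.Realize (M := {x : ZFSet // x ∈ M}) φ

/-- `(M, ∈) ⊨ φ[v₀, …, v_{k-1}]`: satisfaction of the formula `φ` in `M`, with the
(membership-checked) valuation `v` of its free variables. -/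
def ZRealize (M : ZFSet) {k : ℕ} (φ : BF k) (v : Fin k → ZFSet) : Prop :=
  ∀ h : ∀ i, v i ∈ M,
    letI := zfStruct M
    BoundedFormula.Realize (M := {x : ZFSet // x ∈ M}) φ (fun e => e.elim) (fun i => ⟨v i, h i⟩)

/-- `x` is a (von Neumann) ordinal: a transitive set of transitive sets. -/
def IsOrd (x : ZFSet) : Prop := x.IsTransitive ∧ ∀ y ∈ x, ZFSet.IsTransitive y

end CtmForcing

namespace CtmForcing
open FirstOrder FirstOrder.Language
attribute [local instance] zfStruct
universe u w
set_option linter.all false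

section Realize
variable {M : ZFSet.{u}} {α : Type} {n : ℕ} (a : α → {x // x ∈ M}) (v : Fin n → {x // x ∈ M})

theorem rz_memf (e : Empty → {x // x ∈ M}) (i j : Fin n) : (memf i j).Realize e v ↔ (v i : ZFSet) ∈ (v j : ZFSet) := by
  unfold memf
  rw [BoundedFormula.realize_rel₂]
  rfl

theorem rz_eqf (e : Empty → {x // x ∈ M}) (i j : Fin n) : (eqf i j).Realize e v ↔ (v i : ZFSet) = (v j : ZFSet) := by
  unfold eqf
  rw [BoundedFormula.realize_bdEqual]
  exact Subtype.ext_iff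

theorem rz_reindex (e : Empty → {x // x ∈ M}) {m : ℕ} (f : Fin m → Fin n) (φ : BF m) :
    (reindex f φ).Realize e v ↔ φ.Realize e (v ∘ f) := by
  unfold reindex
  refine (BoundedFormula.realize_relabel (m := n) (n := 0) (xs := v)).trans ?_
  have h := BoundedFormula.realize_toFormula φ
    (Sum.elim e ((v ∘ (Fin.castAdd 0 : Fin n → Fin (n+0)))) ∘ (Sum.map id f : Empty ⊕ Fin m → Empty ⊕ Fin n))
  have h2 : ∀ x : Fin 0 → {x // x ∈ M}, x = default := fun x => Subsingleton.elim _ _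
  rw [h2 (v ∘ Fin.natAdd n)]
  refine h.trans ?_
  have h3 : ∀ x : Empty → {x // x ∈ M}, x = e := fun x => Subsingleton.elim _ _
  rw [h3 (_ ∘ Sum.inl)]
  rfl

theorem rz_andF (e : Empty → {x // x ∈ M}) (φ ψ : BF n) : (andF φ ψ).Realize e v ↔ (φ.Realize e v ∧ ψ.Realize e v) := by
  unfold andF
  simp only [BoundedFormula.realize_not, BoundedFormula.realize_imp]; tauto

theorem rz_orF (e : Empty → {x // x ∈ M}) (φ ψ : BF n) : (orF φ ψ).Realize e v ↔ (φ.Realize e v ∨ ψ.Realize e v) := by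
  unfold orF
  simp only [BoundedFormula.realize_not, BoundedFormula.realize_imp]; tauto

theorem rz_iffF (e : Empty → {x // x ∈ M}) (φ ψ : BF n) : (iffF φ ψ).Realize e v ↔ (φ.Realize e v ↔ ψ.Realize e v) := by
  unfold iffF
  simp only [rz_andF, BoundedFormula.realize_imp]; tauto

end Realize

/-- uniform definability with parameters -/
class Dfn {I : Type w} (M : I → ZFSet.{u}) {n : ℕ} (R : I → (Fin n → ZFSet.{u}) → Prop) : Prop where
  out : ∃ (m : ℕ) (φ : SetLang.BoundedFormula (Fin m) n), ∀ i, ∃ a : Fin m → {x // x ∈ M i},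
    ∀ v : Fin n → {x // x ∈ M i}, φ.Realize a v ↔ R i (fun j => (v j : ZFSet))

variable {I : Type w} {M : I → ZFSet.{u}} {n : ℕ}

theorem Dfn.congr {R S : I → (Fin n → ZFSet.{u}) → Prop} (h : Dfn M R)
    (e : ∀ i v, (∀ j, v j ∈ M i) → (R i v ↔ S i v)) : Dfn M S := by
  obtain ⟨m, φ, hφ⟩ := h.out
  refine ⟨m, φ, fun i => ?_⟩
  obtain ⟨a, ha⟩ := hφ i
  exact ⟨a, fun v => (ha v).trans (e i _ fun j => (v j).2)⟩

theorem Dfn.var_mem (j k : Fin n) : Dfn M (fun _ v => v j ∈ v k) :=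
  ⟨0, memSymb.boundedFormula₂ (Term.var (Sum.inr j)) (Term.var (Sum.inr k)),
    fun i => ⟨fun x => x.elim0, fun v => by rw [BoundedFormula.realize_rel₂]; rfl⟩⟩

theorem Dfn.var_eq (j k : Fin n) : Dfn M (fun _ v => v j = v k) :=
  ⟨0, Term.bdEqual (Term.var (Sum.inr j)) (Term.var (Sum.inr k)),
    fun i => ⟨fun x => x.elim0, fun v => by
      rw [BoundedFormula.realize_bdEqual]; exact Subtype.ext_iff⟩⟩

theorem Dfn.eq_const (j : Fin n) (c : I → ZFSet.{u}) (h : ∀ i, c i ∈ M i) :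
    Dfn M (fun i v => v j = c i) :=
  ⟨1, Term.bdEqual (Term.var (Sum.inr j)) (Term.var (Sum.inl 0)),
    fun i => ⟨fun x => ⟨c i, h i⟩, fun v => by
      rw [BoundedFormula.realize_bdEqual]; simp [Subtype.ext_iff]⟩⟩

instance Dfn.false : Dfn M (n := n) (fun _ _ => False) :=
  ⟨0, ⊥, fun i => ⟨fun x => x.elim0, fun v => by simp⟩⟩

instance Dfn.imp {R S : I → (Fin n → ZFSet.{u}) → Prop} [hR : Dfn M R] [hS : Dfn M S] :
    Dfn M (fun i v => R i v → S i v) := by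
  obtain ⟨m, φ, hφ⟩ := hR.out
  obtain ⟨k, ψ, hψ⟩ := hS.out
  refine ⟨m + k, (φ.subst (fun x => Term.var (Fin.castAdd k x))).imp
    (ψ.subst (fun x => Term.var (Fin.natAdd m x))), fun i => ?_⟩
  obtain ⟨a, ha⟩ := hφ i
  obtain ⟨b, hb⟩ := hψ i
  refine ⟨Fin.append a b, fun v => ?_⟩
  rw [BoundedFormula.realize_imp, BoundedFormula.realize_subst, BoundedFormula.realize_subst]
  simp only [Term.realize_var, Fin.append_left, Fin.append_right]
  rw [ha, hb]

instance Dfn.all {R : I → (Fin n → ZFSet.{u}) → ZFSet.{u} → Prop}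
    [hR : Dfn M (n := n + 1) (fun i w => R i (fun j => w j.castSucc) (w (Fin.last n)))] :
    Dfn M (fun i v => ∀ x, x ∈ M i → R i v x) := by
  obtain ⟨m, φ, hφ⟩ := hR.out
  refine ⟨m, φ.all, fun i => ?_⟩
  obtain ⟨a, ha⟩ := hφ i
  refine ⟨a, fun v => ?_⟩
  simp only [BoundedFormula.realize_all, ha, Fin.snoc_castSucc, Fin.snoc_last, Subtype.forall]

instance Dfn.not {R : I → (Fin n → ZFSet.{u}) → Prop} [hR : Dfn M R] :
    Dfn M (fun i v => ¬ R i v) := (inferInstance : Dfn M (fun i v => R i v → False))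

instance Dfn.and {R S : I → (Fin n → ZFSet.{u}) → Prop} [hR : Dfn M R] [hS : Dfn M S] :
    Dfn M (fun i v => R i v ∧ S i v) :=
  (inferInstance : Dfn M (fun i v => ¬ (R i v → ¬ S i v))).congr (by intros; tauto)

instance Dfn.or {R S : I → (Fin n → ZFSet.{u}) → Prop} [hR : Dfn M R] [hS : Dfn M S] :
    Dfn M (fun i v => R i v ∨ S i v) :=
  (inferInstance : Dfn M (fun i v => (¬ R i v → S i v))).congr (by intros; tauto)

instance Dfn.iff {R S : I → (Fin n → ZFSet.{u}) → Prop} [hR : Dfn M R] [hS : Dfn M S] :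
    Dfn M (fun i v => R i v ↔ S i v) :=
  (inferInstance : Dfn M (fun i v => (R i v → S i v) ∧ (S i v → R i v))).congr (by intros; tauto)

instance Dfn.ex {R : I → (Fin n → ZFSet.{u}) → ZFSet.{u} → Prop}
    [hR : Dfn M (n := n + 1) (fun i w => R i (fun j => w j.castSucc) (w (Fin.last n)))] :
    Dfn M (fun i v => ∃ x, x ∈ M i ∧ R i v x) :=
  (inferInstance : Dfn M (fun i v => ¬ ∀ x, x ∈ M i → ¬ R i v x)).congr
    (by intros; push Not; rfl)

theorem Dfn.rename {k : ℕ} {R : I → (Fin n → ZFSet.{u}) → Prop} (h : Dfn M R) (f : Fin n → Fin k) :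
    Dfn M (fun i w => R i (fun j => w (f j))) := by
  obtain ⟨m, φ, hφ⟩ := h.out
  refine ⟨m, (BoundedFormula.relabel (Sum.map id f) φ.toFormula :
    SetLang.BoundedFormula (Fin m) (k + 0)), fun i => ?_⟩
  obtain ⟨a, ha⟩ := hφ i
  refine ⟨a, fun v => ?_⟩
  refine (BoundedFormula.realize_relabel (m := k) (n := 0) (xs := v)).trans ?_
  have h2 : ∀ x : Fin 0 → {x // x ∈ M i}, x = default := fun x => Subsingleton.elim _ _
  rw [h2 (v ∘ Fin.natAdd k)]
  refine (BoundedFormula.realize_toFormula φ _).trans ?_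
  exact ha (v ∘ f)

/-- definable functions -/
class DFun {I : Type w} (M : I → ZFSet.{u}) {n : ℕ} (t : I → (Fin n → ZFSet.{u}) → ZFSet.{u}) : Prop where
  mem : ∀ i v, (∀ j, v j ∈ M i) → t i v ∈ M i
  graph : Dfn M (n := n + 1) (fun i w => w (Fin.last n) = t i (fun j => w j.castSucc))

class Cst {I : Type w} (M : I → ZFSet.{u}) (c : I → ZFSet.{u}) : Prop where
  mem : ∀ i, c i ∈ M i

instance DFun.const {c : I → ZFSet.{u}} [h : Cst M c] : DFun M (n := n) (fun i _ => c i) :=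
  ⟨fun i _ _ => h.mem i, Dfn.eq_const _ _ h.mem⟩

instance DFun.var {j : Fin n} : DFun M (fun _ v => v j) :=
  ⟨fun i v h => h j, Dfn.var_eq _ _⟩

instance DFun.rename {k : ℕ} {t : I → (Fin n → ZFSet.{u}) → ZFSet.{u}} {f : Fin n → Fin k}
    [h : DFun M t] : DFun M (fun i w => t i (fun j => w (f j))) := by
  refine ⟨fun i v hv => h.mem i _ fun j => hv _, ?_⟩
  have := h.graph.rename (Fin.snoc (fun j => (f j).castSucc) (Fin.last k) : Fin (n+1) → Fin (k+1))
  simpa only [Fin.snoc_last, Fin.snoc_castSucc] using this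

theorem Dfn.comp1 {R : I → (Fin (n+1) → ZFSet.{u}) → Prop} (hR : Dfn M R)
    {t : I → (Fin n → ZFSet.{u}) → ZFSet.{u}} [ht : DFun M t] :
    Dfn M (fun i v => R i (Fin.snoc v (t i v) : Fin (n+1) → ZFSet.{u})) := by
  have h1 := ht.graph
  have h2 : Dfn M (n := n + 1) (fun i w => w (Fin.last n) = t i (fun j => w j.castSucc) ∧
     R i (Fin.snoc (fun j => w j.castSucc) (w (Fin.last n)) : Fin (n+1) → ZFSet.{u})) := by
    refine @Dfn.and _ _ _ _ _ h1 (hR.congr ?_)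
    intro i v _
    have : (Fin.snoc (fun j => v j.castSucc) (v (Fin.last n)) : Fin (n+1) → ZFSet.{u}) = v :=
      Fin.snoc_init_self v
    rw [this]
  have h3 := @Dfn.ex I M n (fun i v x => x = t i v ∧ R i (Fin.snoc v x : Fin (n+1) → ZFSet.{u})) h2
  refine h3.congr fun i v hv => ⟨?_, ?_⟩
  · rintro ⟨x, -, rfl, h⟩; exact h
  · intro h; exact ⟨_, ht.mem i v hv, rfl, h⟩

instance Dfn.mem {s t : I → (Fin n → ZFSet.{u}) → ZFSet.{u}} [hs : DFun M s] [ht : DFun M t] :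
    Dfn M (fun i v => s i v ∈ t i v) := by
  have h : Dfn M (n := n + 2) (fun _ w => w (Fin.last n).castSucc ∈ w (Fin.last (n+1))) := Dfn.var_mem _ _
  have h1 := (h.comp1 (t := fun i w => t i (fun j => w j.castSucc))).comp1 (t := s)
  simpa only [Fin.snoc_last, Fin.snoc_castSucc] using h1

instance Dfn.eq {s t : I → (Fin n → ZFSet.{u}) → ZFSet.{u}} [hs : DFun M s] [ht : DFun M t] :
    Dfn M (fun i v => s i v = t i v) := by
  have h : Dfn M (n := n + 2) (fun _ w => w (Fin.last n).castSucc = w (Fin.last (n+1))) := Dfn.var_eq _ _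
  have h1 := (h.comp1 (t := fun i w => t i (fun j => w j.castSucc))).comp1 (t := s)
  simpa only [Fin.snoc_last, Fin.snoc_castSucc] using h1

/-- substitution of many definable functions -/
theorem Dfn.comp {k : ℕ} {R : I → (Fin k → ZFSet.{u}) → Prop} (hR : Dfn M R)
    (t : Fin k → I → (Fin n → ZFSet.{u}) → ZFSet.{u}) [ht : ∀ j, DFun M (t j)] :
    Dfn M (fun i v => R i (fun j => t j i v)) := by
  have key : ∀ (k : ℕ) (Q : I → (Fin (n + k) → ZFSet.{u}) → Prop) (_ : Dfn M Q)
     (t : Fin k → I → (Fin n → ZFSet.{u}) → ZFSet.{u}) (_ : ∀ j, DFun M (t j)),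
     Dfn M (fun i v => Q i (Fin.append v (fun j => t j i v))) := by
    intro k
    induction k with
    | zero =>
      intro Q hQ t _
      refine hQ.congr fun i v _ => ?_
      congr! 1
      funext j
      exact (Fin.append_left v (fun j => t j i v) j).symm
    | succ k ih =>
      intro Q hQ t ht
      have h1 := Dfn.comp1 (n := n + k) (R := Q) hQ
        (t := fun i w => t (Fin.last k) i (fun j => w (Fin.castAdd k j)))
      have h2 := ih _ h1 (fun j => t j.castSucc) (fun j => ht _)
      refine h2.congr fun i v _ => ?_
      simp only [Fin.append_left]
      congr! 1
      rw [← Fin.append_snoc]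
      congr 1
      exact Fin.snoc_init_self (n := k) (α := fun _ => ZFSet.{u}) (fun j => t j i v)
  have h := key k (fun i w => R i (fun j => w (Fin.natAdd n j))) (hR.rename _) t ht
  simpa only [Fin.append_right] using h

theorem DFun.comp {k : ℕ} {F : I → (Fin k → ZFSet.{u}) → ZFSet.{u}} (hF : DFun M F)
    (t : Fin k → I → (Fin n → ZFSet.{u}) → ZFSet.{u}) [ht : ∀ j, DFun M (t j)] :
    DFun M (fun i v => F i (fun j => t j i v)) := by
  refine ⟨fun i v hv => hF.mem i _ fun j => (ht j).mem i v hv, ?_⟩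
  have := hF.graph.comp (n := n + 1) (Fin.snoc (fun j i w => t j i (fun l => w l.castSucc))
    (fun _ w => w (Fin.last n)))
    (ht := fun j => by
      refine Fin.lastCases ?_ (fun j => ?_) j
      · rw [Fin.snoc_last]; infer_instance
      · rw [Fin.snoc_castSucc]; infer_instance)
  simpa only [Fin.snoc_last, Fin.snoc_castSucc] using this

/-- Families of transitive sets -/
class Tr {I : Type w} (M : I → ZFSet.{u}) : Prop where
  tr : ∀ i, (M i).IsTransitive

theorem Tr.mem [h : Tr M] {i : I} {x y : ZFSet.{u}} (hx : x ∈ y) (hy : y ∈ M i) : x ∈ M i :=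
  h.tr i y hy hx

instance Dfn.bex [Tr M] {t : I → (Fin n → ZFSet.{u}) → ZFSet.{u}} [ht : DFun M t]
    {R : I → (Fin n → ZFSet.{u}) → ZFSet.{u} → Prop}
    [hR : Dfn M (n := n + 1) (fun i w => R i (fun j => w j.castSucc) (w (Fin.last n)))] :
    Dfn M (fun i v => ∃ x, x ∈ t i v ∧ R i v x) :=
  (inferInstance : Dfn M (fun i v => ∃ x, x ∈ M i ∧ (x ∈ t i v ∧ R i v x))).congr
    fun i v hv => ⟨fun ⟨x, _, h⟩ => ⟨x, h⟩, fun ⟨x, h⟩ => ⟨x, Tr.mem h.1 (ht.mem i v hv), h⟩⟩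

instance Dfn.ball [Tr M] {t : I → (Fin n → ZFSet.{u}) → ZFSet.{u}} [ht : DFun M t]
    {R : I → (Fin n → ZFSet.{u}) → ZFSet.{u} → Prop}
    [hR : Dfn M (n := n + 1) (fun i w => R i (fun j => w j.castSucc) (w (Fin.last n)))] :
    Dfn M (fun i v => ∀ x, x ∈ t i v → R i v x) :=
  (inferInstance : Dfn M (fun i v => ∀ x, x ∈ M i → (x ∈ t i v → R i v x))).congr
    fun i v hv => ⟨fun h x hx => h x (Tr.mem hx (ht.mem i v hv)) hx, fun h x _ => h x⟩

instance Dfn.sub [Tr M] {s t : I → (Fin n → ZFSet.{u}) → ZFSet.{u}} [hs : DFun M s] [ht : DFun M t] :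
    Dfn M (fun i v => s i v ⊆ t i v) :=
  (inferInstance : Dfn M (fun i v => ∀ x, x ∈ s i v → x ∈ t i v)).congr
    fun i v hv => ⟨fun h x hx => h x hx, fun h x hx => h hx⟩

theorem DFun.of_mem [Tr M] {t : I → (Fin n → ZFSet.{u}) → ZFSet.{u}}
    (R : I → (Fin n → ZFSet.{u}) → ZFSet.{u} → Prop)
    [hR : Dfn M (n := n + 1) (fun i w => R i (fun j => w j.castSucc) (w (Fin.last n)))]
    (hm : ∀ i v, (∀ j, v j ∈ M i) → t i v ∈ M i)
    (h : ∀ i v, (∀ j, v j ∈ M i) → ∀ z ∈ M i, z ∈ t i v ↔ R i v z) : DFun M t := by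
  refine ⟨hm, ?_⟩
  have h2 : Dfn M (n := n + 1 + 1) (fun i w => R i (fun j => w j.castSucc.castSucc) (w (Fin.last (n+1)))) := by
    have := hR.rename (Fin.snoc (fun j => j.castSucc.castSucc) (Fin.last (n+1)) : Fin (n+1) → Fin (n+2))
    simpa only [Fin.snoc_last, Fin.snoc_castSucc] using this
  have h3 : Dfn M (n := n + 1) (fun i w => ∀ x, x ∈ M i → (x ∈ w (Fin.last n) ↔
    R i (fun j => w j.castSucc) x)) := inferInstance
  refine h3.congr fun i v hv => ⟨fun hx => ?_, fun hx x hxM => ?_⟩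
  · ext z
    constructor
    · intro hz
      have hzM := Tr.mem hz (hv _)
      rw [h i _ (fun j => hv _) z hzM]
      exact (hx z hzM).1 hz
    · intro hz
      have hzM := Tr.mem hz (hm i _ (fun j => hv _))
      rw [h i _ (fun j => hv _) z hzM] at hz
      exact (hx z hzM).2 hz
  · rw [hx]; exact h i _ (fun j => hv _) x hxM

end CtmForcing

namespace CtmForcing
open FirstOrder FirstOrder.Language
attribute [local instance] zfStruct
universe u w
set_option linter.all false

section
variable {M : ZFSet.{u}} {n : ℕ}

theorem rz_sepAx (φ : BF (n+1)) : Sentence.Realize {x // x ∈ M} (sepAx φ) ↔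
    ∀ (xs : Fin n → {x // x ∈ M}) (A : {x // x ∈ M}), ∃ B : {x // x ∈ M}, ∀ x : {x // x ∈ M},
      (x : ZFSet) ∈ (B : ZFSet) ↔ (x : ZFSet) ∈ (A : ZFSet) ∧
        φ.Realize (fun e : Empty => e.elim) (Fin.snoc xs x : Fin (n+1) → {x // x ∈ M}) := by
  unfold sepAx Sentence.Realize
  dsimp only
  rw [BoundedFormula.realize_alls]
  have he : (default : Empty → {x // x ∈ M}) = fun e => e.elim := Subsingleton.elim _ _
  rw [he]
  refine forall_congr' fun xs => ?_
  simp only [BoundedFormula.realize_all, BoundedFormula.realize_ex, rz_iffF, rz_andF, rz_memf, rz_reindex]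
  refine forall_congr' fun A => exists_congr fun B => forall_congr' fun x => ?_
  have h : ((Fin.snoc (Fin.snoc (Fin.snoc xs A : Fin (n+1) → {x // x ∈ M}) B : Fin (n+2) → {x // x ∈ M}) x : Fin (n+3) → {x // x ∈ M}) ∘
      (fun i : Fin (n+1) => if h : (i : ℕ) < n then (⟨i, by omega⟩ : Fin (n+3)) else ⟨n+2, by omega⟩)) =
      (Fin.snoc xs x : Fin (n+1) → {x // x ∈ M}) := by
    funext i
    refine Fin.lastCases ?_ (fun j => ?_) i
    · simp [Fin.snoc]
    · have := j.2
      simp only [Fin.snoc, Function.comp, Fin.val_castSucc, this, dif_pos, cast_eq, Fin.castLT_mk]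
      rw [dif_pos (by omega), dif_pos (by omega)]
      rfl
  rw [h]
  simp [Fin.snoc]

theorem rz_replAx (φ : BF (n+2)) : Sentence.Realize {x // x ∈ M} (replAx φ) ↔
    ∀ (xs : Fin n → {x // x ∈ M}) (A : {x // x ∈ M}),
      (∀ x y y' : {x // x ∈ M}, (x : ZFSet) ∈ (A : ZFSet) ∧
        φ.Realize (fun e : Empty => e.elim) (Fin.snoc (Fin.snoc xs x : Fin (n+1) → {x // x ∈ M}) y : Fin (n+2) → {x // x ∈ M}) ∧
        φ.Realize (fun e : Empty => e.elim) (Fin.snoc (Fin.snoc xs x : Fin (n+1) → {x // x ∈ M}) y' : Fin (n+2) → {x // x ∈ M}) → (y : ZFSet) = y') →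
      ∃ B : {x // x ∈ M}, ∀ y : {x // x ∈ M},
      (y : ZFSet) ∈ (B : ZFSet) ↔ ∃ x : {x // x ∈ M}, (x : ZFSet) ∈ (A : ZFSet) ∧
        φ.Realize (fun e : Empty => e.elim) (Fin.snoc (Fin.snoc xs x : Fin (n+1) → {x // x ∈ M}) y : Fin (n+2) → {x // x ∈ M}) := by
  unfold replAx Sentence.Realize
  dsimp only
  rw [BoundedFormula.realize_alls]
  have he : (default : Empty → {x // x ∈ M}) = fun e => e.elim := Subsingleton.elim _ _
  rw [he]
  refine forall_congr' fun xs => ?_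
  simp only [BoundedFormula.realize_all, BoundedFormula.realize_ex, BoundedFormula.realize_imp,
    rz_iffF, rz_andF, rz_memf, rz_eqf, rz_reindex]
  have h : ∀ (A x y z : {x // x ∈ M}) (p q : ℕ) (hp : p < n + 4) (hq : q < n + 4) (a b : {x // x ∈ M}),
      (Fin.snoc (Fin.snoc (Fin.snoc (Fin.snoc xs A : Fin (n+1) → {x // x ∈ M}) x : Fin (n+2) → {x // x ∈ M}) y : Fin (n+3) → {x // x ∈ M}) z : Fin (n+4) → {x // x ∈ M}) ⟨p, hp⟩ = a → 
      (Fin.snoc (Fin.snoc (Fin.snoc (Fin.snoc xs A : Fin (n+1) → {x // x ∈ M}) x : Fin (n+2) → {x // x ∈ M}) y : Fin (n+3) → {x // x ∈ M}) z : Fin (n+4) → {x // x ∈ M}) ⟨q, hq⟩ = b → 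
     ((Fin.snoc (Fin.snoc (Fin.snoc (Fin.snoc xs A : Fin (n+1) → {x // x ∈ M}) x : Fin (n+2) → {x // x ∈ M}) y : Fin (n+3) → {x // x ∈ M}) z : Fin (n+4) → {x // x ∈ M}) ∘
      (fun i : Fin (n+2) => if h : (i : ℕ) < n then (⟨i, by omega⟩ : Fin (n+4)) else 
        if (i : ℕ) = n then ⟨p, hp⟩ else ⟨q, hq⟩)) =
      (Fin.snoc (Fin.snoc xs a : Fin (n+1) → {x // x ∈ M}) b : Fin (n+2) → {x // x ∈ M}) := by
    intro A x y z p q hp hq a b ha hb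
    funext i
    refine Fin.lastCases ?_ (fun i => Fin.lastCases ?_ (fun j => ?_) i) i
    · simp [hb]
    · simp [ha]
    · have := j.2
      simp only [Fin.snoc, Function.comp, Fin.val_castSucc, this, dif_pos, cast_eq, Fin.castLT_mk]
      rw [dif_pos (by omega), dif_pos (by omega), dif_pos (by omega)]
      exact ((dif_pos (show (j : ℕ) < n + 1 by omega)).trans (dif_pos (show (j : ℕ) < n by omega))).symm
  refine forall_congr' fun A => ?_
  refine imp_congr ?_ ?_
  · refine forall_congr' fun x => forall_congr' fun y => forall_congr' fun y' => ?_
    rw [h A x y y' (n+1) (n+2) _ _ x y (by simp [Fin.snoc]) (by simp [Fin.snoc]),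
      h A x y y' (n+1) (n+3) _ _ x y' (by simp [Fin.snoc]) (by simp [Fin.snoc])]
    simp [Fin.snoc]
  · refine exists_congr fun B => forall_congr' fun y => ?_
    refine iff_congr (by simp [Fin.snoc]) (exists_congr fun x => ?_)
    rw [h A B y x (n+3) (n+2) _ _ x y (by simp [Fin.snoc]) (by simp [Fin.snoc])]
    simp [Fin.snoc]

theorem rz_toBF {m k : ℕ} (φ : SetLang.BoundedFormula (Fin m) k) (xs : Fin (m + k) → {x // x ∈ M}) (e : Empty → {x // x ∈ M}) :
    (BoundedFormula.relabel (Sum.inr : Fin m → Empty ⊕ Fin m) φ).Realize e xs ↔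
     φ.Realize (fun j => xs (Fin.castAdd k j)) (fun j => xs (Fin.natAdd m j)) :=
  BoundedFormula.realize_relabel

end

/-- definability in one model -/
abbrev D1 (M : ZFSet.{u}) (Q : ZFSet.{u} → Prop) : Prop :=
  Dfn (fun _ : Unit => M) (n := 1) (fun _ v => Q (v 0))

theorem sepAx_sem {M : ZFSet.{u}} (hM : M.IsTransitive)
    (h : ∀ (n : ℕ) (φ : BF (n+1)), Sentence.Realize {x // x ∈ M} (sepAx φ)) (Q : ZFSet.{u} → Prop) (hQ : D1 M Q)
    (A : ZFSet.{u}) (hA : A ∈ M) : ZFSet.sep Q A ∈ M := by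
  obtain ⟨m, φ, hφ⟩ := hQ.out
  obtain ⟨a, ha⟩ := hφ ()
  obtain ⟨B, hB⟩ := (rz_sepAx _).1 (h m (BoundedFormula.relabel (Sum.inr : Fin m → Empty ⊕ Fin m) φ)) a ⟨A, hA⟩
  have : ZFSet.sep Q A = B := by
    ext x
    rw [ZFSet.mem_sep]
    by_cases hx : x ∈ M
    · have := hB ⟨x, hx⟩
      rw [rz_toBF] at this
      have e1 : (fun j => (Fin.snoc a ⟨x, hx⟩ : Fin (m+1) → {x // x ∈ M}) (Fin.castAdd 1 j)) = a := by
        funext j; exact Fin.snoc_castSucc (α := fun _ => {x // x ∈ M}) _ _ _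
      have e2 : ((Fin.snoc a ⟨x, hx⟩ : Fin (m+1) → {x // x ∈ M}) (Fin.natAdd m 0)) = ⟨x, hx⟩ := by
        exact Fin.snoc_last (α := fun _ => {x // x ∈ M}) _ _
      rw [e1, ha] at this
      dsimp only at this
      rw [e2] at this
      exact this.symm
    · refine iff_of_false (fun h => hx (hM _ hA h.1)) (fun h => hx (hM _ B.2 h))
  rw [this]; exact B.2

/-- satisfaction with a membership-checked valuation -/
def Sat (M : ZFSet.{u}) {k : ℕ} (φ : BF k) (v : Fin k → ZFSet.{u}) : Prop :=
  ∃ h : ∀ j, v j ∈ M, φ.Realize (fun e : Empty => e.elim) (fun j => (⟨v j, h j⟩ : {x // x ∈ M}))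

theorem Sat_coe {M : ZFSet.{u}} {k : ℕ} (φ : BF k) (v : Fin k → {x // x ∈ M}) :
    Sat M φ (fun j => (v j : ZFSet.{u})) ↔ φ.Realize (fun e : Empty => e.elim) v :=
  ⟨fun ⟨_, h⟩ => h, fun h => ⟨fun j => (v j).2, h⟩⟩

theorem Dfn.sat {I : Type w} {M : I → ZFSet.{u}} {k : ℕ} (φ : BF k) : Dfn M (fun i v => Sat (M i) φ v) := by
  refine ⟨0, φ.subst (fun e => e.elim), fun i => ⟨fun j => j.elim0, fun v => ?_⟩⟩
  rw [Sat_coe, BoundedFormula.realize_subst]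
  have : ∀ x y : Empty → {x // x ∈ M i}, x = y := fun x y => Subsingleton.elim _ _
  rw [this (fun _ => _)]

instance Dfn.sat_comp {I : Type w} {M : I → ZFSet.{u}} {n k : ℕ} (φ : BF k) (t : Fin k → I → (Fin n → ZFSet.{u}) → ZFSet.{u})
    [ht : ∀ j, DFun M (t j)] : Dfn M (fun i v => Sat (M i) φ (fun j => t j i v)) :=
  (Dfn.sat φ).comp t

/-- snoc of definable functions -/
theorem DFun.snocs {I : Type w} {M : I → ZFSet.{u}} {n k : ℕ} (t : Fin k → I → (Fin n → ZFSet.{u}) → ZFSet.{u})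
    [ht : ∀ j, DFun M (t j)] (s : I → (Fin n → ZFSet.{u}) → ZFSet.{u}) [hs : DFun M s] :
    ∀ j, DFun M (fun i v => (Fin.snoc (fun j => t j i v) (s i v) : Fin (k+1) → ZFSet.{u}) j) := by
  intro j
  refine Fin.lastCases ?_ (fun j => ?_) j
  · simpa only [Fin.snoc_last] using hs
  · simpa only [Fin.snoc_castSucc] using ht j

theorem snoc_coe {M : ZFSet.{u}} {n : ℕ} (xs : Fin n → {x // x ∈ M}) (x : {x // x ∈ M}) :
    (fun j => ((Fin.snoc xs x : Fin (n+1) → {x // x ∈ M}) j : ZFSet.{u})) =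
      (Fin.snoc (fun j => (xs j : ZFSet.{u})) (x : ZFSet.{u}) : Fin (n+1) → ZFSet.{u}) := by
  funext j
  refine Fin.lastCases ?_ (fun j => ?_) j
  · simp
  · simp

theorem sepAx_of_sem {M : ZFSet.{u}}
    (h : ∀ Q : ZFSet.{u} → Prop, D1 M Q → ∀ A ∈ M, ZFSet.sep Q A ∈ M) 
     (n : ℕ) (φ : BF (n+1)) : Sentence.Realize {x // x ∈ M} (sepAx φ) := by
  rw [rz_sepAx]
  intro xs A
  let Q : ZFSet → Prop := fun x => Sat M φ (Fin.snoc (fun j => (xs j : ZFSet.{u})) x)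
  have hQ : D1 M Q := by
    have : ∀ j, Cst (fun _ : Unit => M) (fun _ => (xs j : ZFSet.{u})) := fun j => ⟨fun _ => (xs j).2⟩
    exact (Dfn.sat φ).comp _ (ht := DFun.snocs (fun j _ _ => (xs j : ZFSet.{u})) (fun _ v => v 0))
  refine ⟨⟨_, h Q hQ A A.2⟩, fun x => ?_⟩
  simp only [ZFSet.mem_sep]
  rw [← Sat_coe, snoc_coe]

/-- semantic version of replacement in `N` -/
theorem replAx_of_sem {M : ZFSet.{u}} {n : ℕ} (φ : BF (n+2))
    (h : ∀ (xs : Fin n → ZFSet.{u}), (∀ j, xs j ∈ M) → ∀ A ∈ M,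
      (∀ x y y', x ∈ M → y ∈ M → y' ∈ M → x ∈ A → Sat M φ (Fin.snoc (Fin.snoc xs x : Fin (n+1) → ZFSet.{u}) y) →
        Sat M φ (Fin.snoc (Fin.snoc xs x : Fin (n+1) → ZFSet.{u}) y') → y = y') →
      ∃ B ∈ M, ∀ y ∈ M, y ∈ B ↔ ∃ x ∈ M, x ∈ A ∧ Sat M φ (Fin.snoc (Fin.snoc xs x : Fin (n+1) → ZFSet.{u}) y)) :
    Sentence.Realize {x // x ∈ M} (replAx φ) := by
  rw [rz_replAx]
  intro xs A hA
  obtain ⟨B, hB, h2⟩ := h (fun j => xs j) (fun j => (xs j).2) A A.2 (by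
    intro x y y' hx hy hy' hxA h1 h2
    refine hA ⟨x, hx⟩ ⟨y, hy⟩ ⟨y', hy'⟩ ⟨hxA, ?_, ?_⟩
    · rw [← Sat_coe, snoc_coe, snoc_coe]; exact h1
    · rw [← Sat_coe, snoc_coe, snoc_coe]; exact h2)
  refine ⟨⟨B, hB⟩, fun y => (h2 y y.2).trans ⟨?_, ?_⟩⟩
  · rintro ⟨x, hx, hxA, h3⟩
    refine ⟨⟨x, hx⟩, hxA, ?_⟩
    rw [← Sat_coe, snoc_coe, snoc_coe]; exact h3
  · rintro ⟨x, hxA, h3⟩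
    refine ⟨x, x.2, hxA, ?_⟩
    rw [← Sat_coe, snoc_coe, snoc_coe] at h3; exact h3

/-- uniform replacement from one instance -/
theorem repl_sem {I : Type w} {M : I → ZFSet.{u}} {k : ℕ} {R : I → (Fin (k+2) → ZFSet.{u}) → Prop} (hR : Dfn M R) :
    ∃ p : Σ n, BF (n+2), ∀ i, Sentence.Realize {x // x ∈ M i} (replAx p.2) →
     ∀ (xs : Fin k → ZFSet.{u}), (∀ j, xs j ∈ M i) → ∀ A ∈ M i,
      (∀ x y y', x ∈ M i → y ∈ M i → y' ∈ M i → x ∈ A → R i (Fin.snoc (Fin.snoc xs x : Fin (k+1) → ZFSet.{u}) y) →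
        R i (Fin.snoc (Fin.snoc xs x : Fin (k+1) → ZFSet.{u}) y') → y = y') →
      ∃ B ∈ M i, ∀ y ∈ M i, y ∈ B ↔ ∃ x ∈ M i, x ∈ A ∧ R i (Fin.snoc (Fin.snoc xs x : Fin (k+1) → ZFSet.{u}) y) := by
  obtain ⟨m, φ, hφ⟩ := hR.out
  refine ⟨⟨m + k, (BoundedFormula.relabel (Sum.inr : Fin m → Empty ⊕ Fin m) φ : BF (m + (k+2)))⟩, fun i hi xs hxs A hA hf => ?_⟩
  obtain ⟨a, ha⟩ := hφ i
  rw [rz_replAx] at hi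
  let ys : Fin k → {x // x ∈ M i} := fun j => ⟨xs j, hxs j⟩
  have key : ∀ x y : {x // x ∈ M i}, (BoundedFormula.relabel (Sum.inr : Fin m → Empty ⊕ Fin m) φ : BF (m + (k+2))).Realize
     (fun e : Empty => e.elim) (Fin.snoc (Fin.snoc (Fin.append a ys) x : Fin (m+k+1) → {x // x ∈ M i}) y : Fin (m+k+2) → {x // x ∈ M i}) ↔
      R i (Fin.snoc (Fin.snoc xs (x : ZFSet.{u}) : Fin (k+1) → ZFSet.{u}) (y : ZFSet.{u})) := by
    intro x y
    have e : (Fin.snoc (Fin.snoc (Fin.append a ys) x : Fin (m+k+1) → {x // x ∈ M i}) y : Fin (m+k+2) → {x // x ∈ M i}) =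
      (Fin.append a (Fin.snoc (Fin.snoc ys x : Fin (k+1) → {x // x ∈ M i}) y : Fin (k+2) → {x // x ∈ M i})) := by
      rw [Fin.append_snoc, Fin.append_snoc]
    rw [e]
    refine (rz_toBF φ _ _).trans ?_
    simp only [Fin.append_left, Fin.append_right]
    rw [ha, snoc_coe, snoc_coe]
  obtain ⟨B, hB⟩ := hi (Fin.append a ys) ⟨A, hA⟩ (by
    rintro ⟨x, hx⟩ ⟨y, hy⟩ ⟨y', hy'⟩ ⟨h1, h2, h3⟩
    exact hf x y y' hx hy hy' h1 ((key _ _).1 h2) ((key _ _).1 h3))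
  refine ⟨B, B.2, fun y hy => (hB ⟨y, hy⟩).trans ⟨?_, ?_⟩⟩
  · rintro ⟨x, hxA, h3⟩
    exact ⟨x, x.2, hxA, (key _ _).1 h3⟩
  · rintro ⟨x, hx, hxA, h3⟩
    exact ⟨⟨x, hx⟩, hxA, (key _ _).2 h3⟩

end CtmForcing

namespace CtmForcing
open FirstOrder FirstOrder.Language
attribute [local instance] zfStruct
universe u w
set_option linter.all false

/-- relative powerset -/
noncomputable def powM (M a : ZFSet.{u}) : ZFSet.{u} := ZFSet.sep (fun z => z ⊆ a) M

theorem mem_powM {M a z : ZFSet.{u}} : z ∈ powM M a ↔ z ∈ M ∧ z ⊆ a := ZFSet.mem_sep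

structure Good (M : ZFSet.{u}) : Prop where
  tr : M.IsTransitive
  pair : ∀ a ∈ M, ∀ b ∈ M, ({a, b} : ZFSet) ∈ M
  union : ∀ a ∈ M, ZFSet.sUnion a ∈ M
  pow : ∀ a ∈ M, powM M a ∈ M
  inf : ∃ A ∈ M, ∅ ∈ A ∧ ∀ x ∈ A, insert x x ∈ A
  sep : ∀ Q, D1 M Q → ∀ A ∈ M, ZFSet.sep Q A ∈ M

section rz
variable {M : ZFSet.{u}} (hM : M.IsTransitive) (e : Empty → {x // x ∈ M})
include hM

theorem rz_subF (v : Fin 2 → {x // x ∈ M}) : subF.Realize e v ↔ (v 0 : ZFSet) ⊆ v 1 := by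
  unfold subF
  simp only [BoundedFormula.realize_all, BoundedFormula.realize_imp, rz_memf]
  exact ⟨fun h x hx => h ⟨x, hM _ (v 0).2 hx⟩ hx, fun h x hx => h hx⟩

theorem rz_emptyF (v : Fin 1 → {x // x ∈ M}) : emptyF.Realize e v ↔ (v 0 : ZFSet) = ∅ := by
  unfold emptyF
  simp only [BoundedFormula.realize_all, BoundedFormula.realize_not, rz_memf]
  rw [ZFSet.eq_empty]
  exact ⟨fun h x hx => h ⟨x, hM _ (v 0).2 hx⟩ hx, fun h x hx => h _ hx⟩

theorem rz_pairSetF (v : Fin 3 → {x // x ∈ M}) : pairSetF.Realize e v ↔ (v 2 : ZFSet) = {(v 0 : ZFSet), (v 1 : ZFSet)} := by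
  unfold pairSetF
  simp only [BoundedFormula.realize_all, rz_iffF, rz_orF, rz_eqf, rz_memf]
  have : ∀ x : {x // x ∈ M}, ((Fin.snoc v x : Fin 4 → {x // x ∈ M}) 3 = x) ∧ ((Fin.snoc v x : Fin 4 → {x // x ∈ M}) 0 = v 0)
     ∧ ((Fin.snoc v x : Fin 4 → {x // x ∈ M}) 1 = v 1) ∧ ((Fin.snoc v x : Fin 4 → {x // x ∈ M}) 2 = v 2) := fun x => ⟨rfl, rfl, rfl, rfl⟩
  simp only [this]
  constructor
  · intro h
    ext x
    rw [ZFSet.mem_pair]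
    constructor
    · intro hx; exact (h ⟨x, hM _ (v 2).2 hx⟩).1 hx
    · rintro (rfl | rfl)
      · exact (h (v 0)).2 (Or.inl rfl)
      · exact (h (v 1)).2 (Or.inr rfl)
  · intro h x; rw [h, ZFSet.mem_pair]

theorem rz_singF (v : Fin 2 → {x // x ∈ M}) : singF.Realize e v ↔ (v 1 : ZFSet) = {(v 0 : ZFSet)} := by
  unfold singF
  rw [rz_reindex, rz_pairSetF hM]
  simp

theorem rz_opF (hp : ∀ a ∈ M, ∀ b ∈ M, ({a, b} : ZFSet) ∈ M) (v : Fin 3 → {x // x ∈ M}) : opF.Realize e v ↔ (v 2 : ZFSet) = ZFSet.pair (v 0) (v 1) := by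
  unfold opF
  simp only [BoundedFormula.realize_all, rz_iffF, rz_orF, rz_eqf, rz_memf, rz_reindex, rz_singF hM, rz_pairSetF hM]
  have : ∀ x : {x // x ∈ M}, ((Fin.snoc v x : Fin 4 → {x // x ∈ M}) 3 = x) ∧ ((Fin.snoc v x : Fin 4 → {x // x ∈ M}) 0 = v 0)
     ∧ ((Fin.snoc v x : Fin 4 → {x // x ∈ M}) 1 = v 1) ∧ ((Fin.snoc v x : Fin 4 → {x // x ∈ M}) 2 = v 2) := fun x => ⟨rfl, rfl, rfl, rfl⟩
  change (∀ x : {x // x ∈ M}, (x : ZFSet) ∈ (v 2 : ZFSet) ↔ ((x : ZFSet) = {(v 0 : ZFSet)} ∨ (x : ZFSet) = {(v 0 : ZFSet), (v 1 : ZFSet)})) ↔ _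
  constructor
  · intro h
    ext x
    rw [ZFSet.pair, ZFSet.mem_pair]
    constructor
    · intro hx; exact (h ⟨x, hM _ (v 2).2 hx⟩).1 hx
    · rintro (rfl | rfl)
      · refine (h ⟨{(v 0 : ZFSet)}, ?_⟩).2 (Or.inl rfl)
        have := hp _ (v 0).2 _ (v 0).2
        simpa using this
      · exact (h ⟨_, hp _ (v 0).2 _ (v 1).2⟩).2 (Or.inr rfl)
  · intro h x; rw [h, ZFSet.pair, ZFSet.mem_pair]

theorem rz_succF (v : Fin 2 → {x // x ∈ M}) : succF.Realize e v ↔ (v 1 : ZFSet) = insert (v 0 : ZFSet) (v 0 : ZFSet) := by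
  unfold succF
  simp only [BoundedFormula.realize_all, rz_iffF, rz_orF, rz_eqf, rz_memf, rz_reindex, rz_singF hM, rz_pairSetF hM]
  change (∀ x : {x // x ∈ M}, (x : ZFSet) ∈ (v 1 : ZFSet) ↔ ((x : ZFSet) ∈ (v 0 : ZFSet) ∨ (x : ZFSet) = (v 0 : ZFSet))) ↔ _
  constructor
  · intro h
    ext x
    rw [ZFSet.mem_insert_iff]
    constructor
    · intro hx; exact ((h ⟨x, hM _ (v 1).2 hx⟩).1 hx).symm
    · rintro (rfl | hx)
      · exact (h (v 0)).2 (Or.inr rfl)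
      · exact (h ⟨x, hM _ (v 0).2 hx⟩).2 (Or.inl hx)
  · intro h x; rw [h, ZFSet.mem_insert_iff]; exact or_comm

theorem rz_transF (v : Fin 1 → {x // x ∈ M}) : transF.Realize e v ↔ (v 0 : ZFSet).IsTransitive := by
  unfold transF
  simp only [BoundedFormula.realize_all, BoundedFormula.realize_imp, rz_memf, rz_reindex, rz_subF hM]
  change (∀ x : {x // x ∈ M}, (x : ZFSet) ∈ (v 0 : ZFSet) → (x : ZFSet) ⊆ (v 0 : ZFSet)) ↔ _
  exact ⟨fun h x hx => h ⟨x, hM _ (v 0).2 hx⟩ hx, fun h x hx => h _ hx⟩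

theorem rz_ordF (v : Fin 1 → {x // x ∈ M}) : ordF.Realize e v ↔ IsOrd (v 0 : ZFSet) := by
  unfold ordF
  simp only [BoundedFormula.realize_all, BoundedFormula.realize_imp, rz_memf, rz_reindex, rz_andF, rz_transF hM]
  change (_ ∧ ∀ x : {x // x ∈ M}, (x : ZFSet) ∈ (v 0 : ZFSet) → (x : ZFSet).IsTransitive) ↔ _
  exact and_congr Iff.rfl ⟨fun h x hx => h ⟨x, hM _ (v 0).2 hx⟩ hx, fun h x hx => h _ hx⟩

theorem rz_relMemF (hp : ∀ a ∈ M, ∀ b ∈ M, ({a, b} : ZFSet) ∈ M) (v : Fin 3 → {x // x ∈ M}) :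
    relMemF.Realize e v ↔ ZFSet.pair (v 0) (v 1) ∈ (v 2 : ZFSet) := by
  unfold relMemF
  simp only [BoundedFormula.realize_ex, rz_memf, rz_reindex, rz_andF, rz_opF hM e hp]
  change (∃ x : {x // x ∈ M}, (x : ZFSet) = ZFSet.pair (v 0) (v 1) ∧ (x : ZFSet) ∈ (v 2 : ZFSet)) ↔ _
  constructor
  · rintro ⟨x, h1, h2⟩; rwa [← h1]
  · intro h; exact ⟨⟨_, hM _ (v 2).2 h⟩, rfl, h⟩

/-- `g` is a surjection from `a` onto `b` -/
def IsSurj (a b g : ZFSet.{u}) : Prop :=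
  (∀ z ∈ g, ∃ x ∈ a, ∃ y ∈ b, z = ZFSet.pair x y) ∧ (∀ x ∈ a, ∃ y ∈ b, ZFSet.pair x y ∈ g) ∧
  (∀ x y y', ZFSet.pair x y ∈ g → ZFSet.pair x y' ∈ g → y = y') ∧
  ∀ y ∈ b, ∃ x ∈ a, ZFSet.pair x y ∈ g

theorem pair_mem_left {x y g : ZFSet.{u}} (hg : g ∈ M) (h : ZFSet.pair x y ∈ g) : x ∈ M ∧ y ∈ M := by
  have h1 := hM _ hg h
  have h2 : ({x, y} : ZFSet) ∈ M := hM _ h1 (by rw [ZFSet.pair, ZFSet.mem_pair]; exact Or.inr rfl)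
  exact ⟨hM _ h2 (by simp), hM _ h2 (by simp)⟩

theorem rz_isFuncF (hp : ∀ a ∈ M, ∀ b ∈ M, ({a, b} : ZFSet) ∈ M) (v : Fin 3 → {x // x ∈ M}) :
    isFuncF.Realize e v ↔ IsSurj (v 0) (v 1) (v 2) := by
  unfold isFuncF
  simp only [BoundedFormula.realize_all, BoundedFormula.realize_imp, BoundedFormula.realize_ex, rz_memf, rz_eqf, rz_reindex, rz_andF, rz_relMemF hM e hp, rz_opF hM e hp]
  change (((∀ z : {x // x ∈ M}, (z : ZFSet) ∈ (v 2 : ZFSet) → ∃ x y : {x // x ∈ M}, ((x : ZFSet) ∈ (v 0 : ZFSet) ∧ (y : ZFSet) ∈ (v 1 : ZFSet)) ∧ (z : ZFSet) = ZFSet.pair x y) ∧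
    (∀ x : {x // x ∈ M}, (x : ZFSet) ∈ (v 0 : ZFSet) → ∃ y : {x // x ∈ M}, (y : ZFSet) ∈ (v 1 : ZFSet) ∧ ZFSet.pair x y ∈ (v 2 : ZFSet))) ∧
    (∀ x y y' : {x // x ∈ M}, ZFSet.pair x y ∈ (v 2 : ZFSet) ∧ ZFSet.pair x y' ∈ (v 2 : ZFSet) → (y : ZFSet) = y') ∧
    (∀ y : {x // x ∈ M}, (y : ZFSet) ∈ (v 1 : ZFSet) → ∃ x : {x // x ∈ M}, (x : ZFSet) ∈ (v 0 : ZFSet) ∧ ZFSet.pair x y ∈ (v 2 : ZFSet))) ↔ _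
  have t : ∀ (j : Fin 3) {x : ZFSet}, x ∈ (v j : ZFSet) → x ∈ M := fun j x hx => hM _ (v j).2 hx
  constructor
  · rintro ⟨⟨h1, h2⟩, h3, h4⟩
    refine ⟨fun z hz => ?_, fun x hx => ?_, fun x y y' h h' => ?_, fun y hy => ?_⟩
    · obtain ⟨x, y, ⟨hx, hy⟩, h⟩ := h1 ⟨z, t 2 hz⟩ hz
      exact ⟨x, hx, y, hy, h⟩
    · obtain ⟨y, h⟩ := h2 ⟨x, t 0 hx⟩ hx
      exact ⟨y, h⟩
    · have a := pair_mem_left hM (v 2).2 h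
      have b := pair_mem_left hM (v 2).2 h'
      exact h3 ⟨x, a.1⟩ ⟨y, a.2⟩ ⟨y', b.2⟩ ⟨h, h'⟩
    · obtain ⟨x, h⟩ := h4 ⟨y, t 1 hy⟩ hy
      exact ⟨x, h⟩
  · rintro ⟨h1, h2, h3, h4⟩
    refine ⟨⟨fun z hz => ?_, fun x hx => ?_⟩, fun x y y' h => h3 _ _ _ h.1 h.2, fun y hy => ?_⟩
    · obtain ⟨x, hx, y, hy, h⟩ := h1 z hz
      exact ⟨⟨x, t 0 hx⟩, ⟨y, t 1 hy⟩, ⟨hx, hy⟩, h⟩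
    · obtain ⟨y, hy, h⟩ := h2 x hx
      exact ⟨⟨y, t 1 hy⟩, hy, h⟩
    · obtain ⟨x, hx, h⟩ := h4 y hy
      exact ⟨⟨x, t 0 hx⟩, hx, h⟩

theorem rz_acAx (hp : ∀ a ∈ M, ∀ b ∈ M, ({a, b} : ZFSet) ∈ M) :
    Sentence.Realize {x // x ∈ M} acAx ↔ ∀ a ∈ M, ∃ o ∈ M, ∃ g ∈ M, IsOrd o ∧ IsSurj o a g := by
  unfold acAx Sentence.Realize Formula.Realize
  simp only [BoundedFormula.realize_all, BoundedFormula.realize_imp, BoundedFormula.realize_ex, rz_memf, rz_eqf, rz_reindex, rz_andF, rz_isFuncF hM _ hp, rz_ordF hM]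
  change (∀ a : {x // x ∈ M}, ∃ o g : {x // x ∈ M}, IsOrd o ∧ IsSurj o a g) ↔ _
  constructor
  · intro h a ha
    obtain ⟨o, g, h⟩ := h ⟨a, ha⟩
    exact ⟨o, o.2, g, g.2, h⟩
  · intro h a
    obtain ⟨o, ho, g, hg, h⟩ := h a a.2
    exact ⟨⟨o, ho⟩, ⟨g, hg⟩, h⟩

theorem rz_pairAx : Sentence.Realize {x // x ∈ M} pairAx ↔ ∀ a ∈ M, ∀ b ∈ M, ({a, b} : ZFSet) ∈ M := by
  unfold pairAx Sentence.Realize Formula.Realize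
  simp only [BoundedFormula.realize_all, BoundedFormula.realize_ex, rz_pairSetF hM]
  change (∀ a b : {x // x ∈ M}, ∃ c : {x // x ∈ M}, (c : ZFSet) = {(a : ZFSet), (b : ZFSet)}) ↔ _
  constructor
  · intro h a ha b hb
    obtain ⟨c, h⟩ := h ⟨a, ha⟩ ⟨b, hb⟩
    rw [← h]; exact c.2
  · intro h a b; exact ⟨⟨_, h _ a.2 _ b.2⟩, rfl⟩

theorem rz_unionAx : Sentence.Realize {x // x ∈ M} unionAx ↔ ∀ a ∈ M, ZFSet.sUnion a ∈ M := by
  unfold unionAx Sentence.Realize Formula.Realize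
  simp only [BoundedFormula.realize_all, BoundedFormula.realize_ex, rz_iffF, rz_memf, rz_andF]
  change (∀ a : {x // x ∈ M}, ∃ c : {x // x ∈ M}, ∀ z : {x // x ∈ M}, (z : ZFSet) ∈ (c : ZFSet) ↔ ∃ y : {x // x ∈ M}, (y : ZFSet) ∈ (a : ZFSet) ∧ (z : ZFSet) ∈ (y : ZFSet)) ↔ _
  constructor
  · intro h a ha
    obtain ⟨c, h⟩ := h ⟨a, ha⟩
    have : ZFSet.sUnion a = c := by
      ext z
      rw [ZFSet.mem_sUnion]
      constructor
      · rintro ⟨y, hy, hz⟩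
        have hyM := hM _ ha hy
        exact (h ⟨z, hM _ hyM hz⟩).2 ⟨⟨y, hyM⟩, hy, hz⟩
      · intro hz
        obtain ⟨y, hy, hz⟩ := (h ⟨z, hM _ c.2 hz⟩).1 hz
        exact ⟨y, hy, hz⟩
    rw [this]; exact c.2
  · intro h a
    refine ⟨⟨_, h _ a.2⟩, fun z => ?_⟩
    rw [ZFSet.mem_sUnion]
    constructor
    · rintro ⟨y, hy, hz⟩
      exact ⟨⟨y, hM _ a.2 hy⟩, hy, hz⟩
    · rintro ⟨y, h⟩; exact ⟨y, h⟩

theorem rz_powAx : Sentence.Realize {x // x ∈ M} powAx ↔ ∀ a ∈ M, powM M a ∈ M := by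
  unfold powAx Sentence.Realize Formula.Realize powF
  simp only [BoundedFormula.realize_all, BoundedFormula.realize_ex, rz_iffF, rz_memf, rz_reindex, rz_subF hM]
  change (∀ a : {x // x ∈ M}, ∃ c : {x // x ∈ M}, ∀ z : {x // x ∈ M}, (z : ZFSet) ∈ (c : ZFSet) ↔ (z : ZFSet) ⊆ (a : ZFSet)) ↔ _
  constructor
  · intro h a ha
    obtain ⟨c, h⟩ := h ⟨a, ha⟩
    have : powM M a = c := by
      ext z
      rw [mem_powM]
      exact ⟨fun hz => (h ⟨z, hz.1⟩).2 hz.2, fun hz => ⟨hM _ c.2 hz, (h ⟨z, hM _ c.2 hz⟩).1 hz⟩⟩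
    rw [this]; exact c.2
  · intro h a
    exact ⟨⟨_, h _ a.2⟩, fun z => mem_powM.trans ⟨fun h => h.2, fun h => ⟨z.2, h⟩⟩⟩

theorem rz_infAx : Sentence.Realize {x // x ∈ M} infAx ↔ ∃ A ∈ M, ∅ ∈ A ∧ ∀ x ∈ A, insert x x ∈ A := by
  unfold infAx Sentence.Realize Formula.Realize
  simp only [BoundedFormula.realize_all, BoundedFormula.realize_ex, BoundedFormula.realize_imp, rz_andF, rz_memf, rz_reindex, rz_emptyF hM, rz_succF hM]
  change (∃ a : {x // x ∈ M}, (∃ z : {x // x ∈ M}, (z : ZFSet) ∈ (a : ZFSet) ∧ (z : ZFSet) = ∅) ∧ 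
     ∀ x : {x // x ∈ M}, (x : ZFSet) ∈ (a : ZFSet) → ∃ z : {x // x ∈ M}, (z : ZFSet) ∈ (a : ZFSet) ∧ (z : ZFSet) = insert (x : ZFSet) (x : ZFSet)) ↔ _
  constructor
  · rintro ⟨a, ⟨z, hz, h0⟩, h⟩
    refine ⟨a, a.2, h0 ▸ hz, fun x hx => ?_⟩
    obtain ⟨z, hz, h0⟩ := h ⟨x, hM _ a.2 hx⟩ hx
    exact h0 ▸ hz
  · rintro ⟨a, ha, h0, h⟩
    refine ⟨⟨a, ha⟩, ⟨⟨_, hM _ ha h0⟩, h0, rfl⟩, fun x hx => ⟨⟨_, hM _ ha (h _ hx)⟩, h _ hx, rfl⟩⟩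

theorem rz_extAx : Sentence.Realize {x // x ∈ M} extAx := by
  unfold extAx Sentence.Realize Formula.Realize
  simp only [BoundedFormula.realize_all, BoundedFormula.realize_ex, BoundedFormula.realize_imp, rz_andF, rz_eqf, rz_memf, rz_reindex, rz_subF hM]
  change ∀ a b : {x // x ∈ M}, (a : ZFSet) ⊆ b ∧ (b : ZFSet) ⊆ a → (a : ZFSet) = b
  intro a b h
  exact subset_antisymm h.1 h.2

theorem rz_foundAx : Sentence.Realize {x // x ∈ M} foundAx := by
  unfold foundAx Sentence.Realize Formula.Realize
  simp only [BoundedFormula.realize_all, BoundedFormula.realize_ex, BoundedFormula.realize_imp, BoundedFormula.realize_not, rz_andF, rz_eqf, rz_memf, rz_reindex, rz_subF hM]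
  change ∀ a : {x // x ∈ M}, (∃ b : {x // x ∈ M}, (b : ZFSet) ∈ (a : ZFSet)) → ∃ b : {x // x ∈ M}, (b : ZFSet) ∈ (a : ZFSet) ∧
     ∀ z : {x // x ∈ M}, (z : ZFSet) ∈ (a : ZFSet) → ¬ (z : ZFSet) ∈ (b : ZFSet)
  rintro a ⟨b, hb⟩
  obtain ⟨y, hy, h⟩ := ZFSet.regularity (a : ZFSet) (by rintro h; rw [h] at hb; exact ZFSet.notMem_empty _ hb)
  refine ⟨⟨y, hM _ a.2 hy⟩, hy, fun z hz hzy => ?_⟩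
  have : (z : ZFSet) ∈ (a : ZFSet) ∩ y := ZFSet.mem_inter.2 ⟨hz, hzy⟩
  rw [h] at this; exact ZFSet.notMem_empty _ this

theorem Good.of_Z (h : ZModels M Z) : Good M := by
  have h1 : ∀ s ∈ zfFin, Sentence.Realize {x // x ∈ M} s := fun s hs => h s (Or.inl hs)
  refine ⟨hM, (rz_pairAx hM).1 (h1 _ (by simp [zfFin])), (rz_unionAx hM).1 (h1 _ (by simp [zfFin])),
    (rz_powAx hM).1 (h1 _ (by simp [zfFin])), (rz_infAx hM).1 (h1 _ (by simp [zfFin])), ?_⟩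
  exact fun Q hQ A hA => sepAx_sem hM (fun n φ => h _ (Or.inr ⟨⟨n, φ⟩, rfl⟩)) Q hQ A hA

end rz

theorem Good.models {M : ZFSet.{u}} (h : Good M) : ZModels M Z := by
  rintro s (hs | ⟨⟨n, φ⟩, rfl⟩)
  · rcases hs with rfl | rfl | rfl | rfl | rfl | rfl
    · exact rz_extAx h.tr
    · exact rz_foundAx h.tr
    · exact (rz_pairAx h.tr).2 h.pair
    · exact (rz_unionAx h.tr).2 h.union
    · exact (rz_powAx h.tr).2 h.pow
    · exact (rz_infAx h.tr).2 h.inf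
  · exact sepAx_of_sem h.sep n φ

end CtmForcing

namespace CtmForcing
open FirstOrder FirstOrder.Language
attribute [local instance] zfStruct
universe u w
set_option linter.all false

class GF {I : Type w} (M : I → ZFSet.{u}) : Prop where
  good : ∀ i, Good (M i)

instance GF.toTr {I : Type w} {M : I → ZFSet.{u}} [h : GF M] : Tr M := ⟨fun i => (h.good i).tr⟩

instance GF.unit {M : ZFSet.{u}} [h : Fact (Good M)] : GF (fun _ : Unit => M) := ⟨fun _ => h.out⟩

section
variable {I : Type w} {M : I → ZFSet.{u}} {n : ℕ}

theorem Dfn.pull {J : Type*} {R : I → (Fin n → ZFSet.{u}) → Prop} (hR : Dfn M R) (f : J → I) :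
    Dfn (fun j => M (f j)) (fun j v => R (f j) v) := by
  obtain ⟨m, φ, h⟩ := hR.out
  exact ⟨m, φ, fun j => h (f j)⟩

theorem Dfn.toD1 {R : I → (Fin (n+1) → ZFSet.{u}) → Prop} (hR : Dfn M R) (i : I) (v : Fin n → ZFSet.{u})
    (hv : ∀ j, v j ∈ M i) : D1 (M i) (fun z => R i (Fin.snoc v z : Fin (n+1) → ZFSet.{u})) := by
  have h := hR.pull (fun _ : Unit => i)
  have : ∀ j, Cst (fun _ : Unit => M i) (fun _ => v j) := fun j => ⟨fun _ => hv j⟩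
  exact h.comp _ (ht := DFun.snocs (M := fun _ : Unit => M i) (fun j _ _ => v j) (fun _ v => v 0))

variable [hM : GF M]

theorem good_sep {R : I → (Fin n → ZFSet.{u}) → ZFSet.{u} → Prop}
    (hR : Dfn M (n := n + 1) (fun i w => R i (fun j => w j.castSucc) (w (Fin.last n)))) {i : I} {v : Fin n → ZFSet.{u}}
    (hv : ∀ j, v j ∈ M i) {A : ZFSet.{u}} (hA : A ∈ M i) : ZFSet.sep (R i v) A ∈ M i := by
  have := (hM.good i).sep _ (hR.toD1 i v hv) A hA
  simpa only [Fin.snoc_last, Fin.snoc_castSucc] using this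

instance DFun.sep {R : I → (Fin n → ZFSet.{u}) → ZFSet.{u} → Prop} {t : I → (Fin n → ZFSet.{u}) → ZFSet.{u}}
    [ht : DFun M t]
    [hR : Dfn M (n := n + 1) (fun i w => R i (fun j => w j.castSucc) (w (Fin.last n)))] :
    DFun M (fun i v => ZFSet.sep (fun z => R i v z) (t i v)) :=
  DFun.of_mem (fun i v z => z ∈ t i v ∧ R i v z)
   (fun i v hv => good_sep hR hv (ht.mem i v hv)) (fun i v hv z hz => ZFSet.mem_sep)

theorem Good.singleton {M : ZFSet.{u}} (h : Good M) {a : ZFSet.{u}} (ha : a ∈ M) : ({a} : ZFSet.{u}) ∈ M := by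
  have := h.pair a ha a ha
  simpa using this

theorem Good.un {M : ZFSet.{u}} (h : Good M) {a b : ZFSet.{u}} (ha : a ∈ M) (hb : b ∈ M) : a ∪ b ∈ M := by
  have := h.union _ (h.pair a ha b hb)
  have e : ZFSet.sUnion {a, b} = a ∪ b := by ext; simp
  rwa [e] at this

theorem Good.insert {M : ZFSet.{u}} (h : Good M) {a b : ZFSet.{u}} (ha : a ∈ M) (hb : b ∈ M) : insert a b ∈ M := by
  have := h.un (h.singleton ha) hb
  have e : {a} ∪ b = Insert.insert a b := by ext; simp
  rwa [e] at this

theorem Good.opair {M : ZFSet.{u}} (h : Good M) {a b : ZFSet.{u}} (ha : a ∈ M) (hb : b ∈ M) : ZFSet.pair a b ∈ M :=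
  h.pair _ (h.singleton ha) _ (h.pair a ha b hb)

theorem Good.empty {M : ZFSet.{u}} (h : Good M) : ∅ ∈ M := by
  obtain ⟨A, hA, h0, -⟩ := h.inf
  exact h.tr _ hA h0

instance DFun.empty : DFun M (n := n) (fun i v => (∅ : ZFSet.{u})) :=
  @DFun.const _ M n (fun _ => ∅) ⟨fun i => (hM.good i).empty⟩

section
variable {s t : I → (Fin n → ZFSet.{u}) → ZFSet.{u}} [hs : DFun M s] [ht : DFun M t]

instance DFun.singleton : DFun M (fun i v => ({t i v} : ZFSet.{u})) :=
  DFun.of_mem (fun i v z => z = t i v) (fun i v hv => (hM.good i).singleton (ht.mem i v hv))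
    (fun i v hv z hz => by simp)

instance DFun.insert : DFun M (fun i v => (insert (s i v) (t i v) : ZFSet.{u})) :=
  DFun.of_mem (fun i v z => z = s i v ∨ z ∈ t i v) (fun i v hv => (hM.good i).insert (hs.mem i v hv) (ht.mem i v hv))
    (fun i v hv z hz => by simp)

instance DFun.union : DFun M (fun i v => (s i v ∪ t i v : ZFSet.{u})) :=
  DFun.of_mem (fun i v z => z ∈ s i v ∨ z ∈ t i v) (fun i v hv => (hM.good i).un (hs.mem i v hv) (ht.mem i v hv))
    (fun i v hv z hz => by simp)

instance DFun.inter : DFun M (fun i v => (s i v ∩ t i v : ZFSet.{u})) := by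
  have e : (fun i v => (s i v ∩ t i v : ZFSet.{u})) = fun i v => ZFSet.sep (fun z => z ∈ t i v) (s i v) := by
    funext i v; ext; simp
  rw [e]; infer_instance

instance DFun.sUnion : DFun M (fun i v => (ZFSet.sUnion (t i v) : ZFSet.{u})) :=
  DFun.of_mem (fun i v z => ∃ y, y ∈ t i v ∧ z ∈ y) (fun i v hv => (hM.good i).union _ (ht.mem i v hv))
    (fun i v hv z hz => by simp)

instance DFun.opair : DFun M (fun i v => ZFSet.pair (s i v) (t i v)) := by
  unfold ZFSet.pair; infer_instance

instance DFun.powM : DFun M (fun i v => powM (M i) (t i v)) :=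
  DFun.of_mem (fun i v z => z ⊆ t i v) (fun i v hv => (hM.good i).pow _ (ht.mem i v hv))
    (fun i v hv z hz => by rw [mem_powM]; simp [hz])

theorem mem_of_pair {M g x y : ZFSet.{u}} (hM : Good M) (h : ZFSet.pair x y ∈ M) : x ∈ M ∧ y ∈ M := by
  exact pair_mem_left (g := {ZFSet.pair x y}) hM.tr (hM.singleton h) (by simp)

instance DFun.prod : DFun M (fun i v => ZFSet.prod (s i v) (t i v)) := by
  have e : (fun i v => ZFSet.prod (s i v) (t i v)) = fun i v => ZFSet.prod (s i v) (t i v) := rfl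
  refine DFun.of_mem (fun i v z => ∃ x, x ∈ s i v ∧ ∃ y, y ∈ t i v ∧ z = ZFSet.pair x y) (fun i v hv => ?_) (fun i v hv z hz => by
    rw [ZFSet.mem_prod])
  have d : DFun M (fun i v => ZFSet.sep (fun z => ∃ x, x ∈ s i v ∧ ∃ y, y ∈ t i v ∧ z = ZFSet.pair x y) 
    (CtmForcing.powM (M i) (CtmForcing.powM (M i) (s i v ∪ t i v)))) := inferInstance
  have := d.mem i v hv
  convert this using 1
  have hs := hs.mem i v hv
  have ht := ht.mem i v hv
  have g := hM.good i
  ext z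
  rw [ZFSet.mem_prod, ZFSet.mem_sep]
  refine ⟨fun h => ⟨?_, h⟩, fun h => h.2⟩
  obtain ⟨x, hx, y, hy, rfl⟩ := h
  have hx' := g.tr _ hs hx
  have hy' := g.tr _ ht hy
  refine mem_powM.2 ⟨g.opair hx' hy', fun z hz => ?_⟩
  rw [ZFSet.pair, ZFSet.mem_pair] at hz
  rcases hz with rfl | rfl
  · refine mem_powM.2 ⟨g.singleton hx', fun z hz => ?_⟩
    simp at hz; simp [hz, hx]
  · refine mem_powM.2 ⟨g.pair _ hx' _ hy', fun z hz => ?_⟩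
    simp at hz; rcases hz with rfl | rfl <;> simp [hx, hy]

end
end

/-- tests -/
example (M : ZFSet.{u}) [Fact (Good M)] (a : ZFSet) (ha : a ∈ M) : D1 M (fun z => ∃ x ∈ M, ∃ y ∈ x, ZFSet.pair x y = z ∧ x ∈ a) := by
  have : Cst (fun _ : Unit => M) (fun _ => a) := ⟨fun _ => ha⟩
  infer_instance

end CtmForcing

namespace CtmForcing
open FirstOrder FirstOrder.Language
attribute [local instance] zfStruct
universe u w
set_option linter.all false

abbrev I0 := {M : ZFSet.{u} // Good M}
abbrev M0 : I0.{u} → ZFSet.{u} := fun i => i.1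
instance : GF M0.{u} := ⟨fun i => i.2⟩

def Att (H : ZFSet.{u} → ZFSet.{u} → ZFSet.{u}) (M f : ZFSet.{u}) : Prop :=
  ∀ y, y ∈ M → ∀ c, c ∈ M → ZFSet.pair y c ∈ f → (∀ z, z ∈ y → ∃ d, d ∈ M ∧ ZFSet.pair z d ∈ f) ∧
    ∃ u, u ∈ M ∧ (∀ d, d ∈ M → (d ∈ u ↔ ∃ z, z ∈ y ∧ ZFSet.pair z d ∈ f)) ∧ c = H M u

theorem Good.pair_of {M x y g : ZFSet.{u}} (h : Good M) (hg : g ∈ M) (hp : ZFSet.pair x y ∈ g) : x ∈ M ∧ y ∈ M :=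
  pair_mem_left h.tr hg hp

/-- the image of `y` under the relation `f` -/
noncomputable def imgs (f y : ZFSet.{u}) : ZFSet.{u} :=
  ZFSet.sep (fun d => ∃ z, z ∈ y ∧ ZFSet.pair z d ∈ f) (ZFSet.sUnion (ZFSet.sUnion f))

theorem mem_imgs {f y d : ZFSet.{u}} : d ∈ imgs f y ↔ ∃ z ∈ y, ZFSet.pair z d ∈ f := by
  rw [imgs, ZFSet.mem_sep]
  refine ⟨fun h => h.2, fun h => ⟨?_, h⟩⟩
  obtain ⟨z, _, hz⟩ := h
  rw [ZFSet.mem_sUnion]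
  refine ⟨{z, d}, ?_, by simp⟩
  rw [ZFSet.mem_sUnion]
  refine ⟨_, hz, by simp [ZFSet.pair]⟩

instance DFun.imgs {I : Type w} {M : I → ZFSet.{u}} {n : ℕ} [GF M] {s t : I → (Fin n → ZFSet.{u}) → ZFSet.{u}} [hs : DFun M s] [ht : DFun M t] :
    DFun M (fun i v => imgs (s i v) (t i v)) := by
  unfold CtmForcing.imgs; infer_instance

theorem Good.imgs {M f y : ZFSet.{u}} (h : Good M) (hf : f ∈ M) (hy : y ∈ M) : imgs f y ∈ M := by
  have : Fact (Good M) := ⟨h⟩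
  have d : DFun (fun _ : Unit => M) (fun _ (v : Fin 2 → ZFSet.{u}) => CtmForcing.imgs (v 0) (v 1)) := inferInstance
  exact d.mem () ![f, y] (fun j => by fin_cases j <;> assumption)

theorem recursion (H F : ZFSet.{u} → ZFSet.{u} → ZFSet.{u}) (hH : DFun M0.{u} (n := 1) (fun i v => H i.1 (v 0)))
    (hF : ∀ M, Good M → ∀ x ∈ M, ∀ u ∈ M, (∀ d, d ∈ u ↔ ∃ y ∈ x, d = F M y) → F M x = H M u) :
    ∃ p : Σ n, BF (n+2), ∀ {J : Type w} (N : J → ZFSet.{u}) [GF N], (∀ j, Sentence.Realize {x // x ∈ N j} (replAx p.2)) →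
      DFun N (n := 1) (fun j v => F (N j) (v 0)) := by
  have hH' : ∀ {n : ℕ} {t : I0.{u} → (Fin n → ZFSet.{u}) → ZFSet.{u}} [DFun M0 t], DFun M0 (fun i v => H i.1 (t i v)) :=
    fun {n t} _ => hH.comp (fun _ => t)
  have hAtt : ∀ {n : ℕ} {t : I0.{u} → (Fin n → ZFSet.{u}) → ZFSet.{u}} [DFun M0 t], Dfn M0 (fun i v => Att H i.1 (t i v)) := by
    intro n t _; unfold Att; infer_instance
  have hR : Dfn M0.{u} (n := 0 + 2) (fun i v => Att H i.1 (v 1) ∧ (∃ c, c ∈ i.1 ∧ ZFSet.pair (v 0) c ∈ v 1) ∧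
     ∀ g, g ∈ i.1 → Att H i.1 g → (∃ c, c ∈ i.1 ∧ ZFSet.pair (v 0) c ∈ g) → v 1 ⊆ g) := inferInstance
  obtain ⟨p, hp⟩ := repl_sem hR
  have hG : Dfn M0.{u} (n := 2) (fun i v => ∃ f, f ∈ i.1 ∧ Att H i.1 f ∧ ZFSet.pair (v 0) (v 1) ∈ f) := inferInstance
  refine ⟨p, fun {J} N hN hrep => ?_⟩
  have A1 : ∀ M, Good M → ∀ f ∈ M, Att H M f → ∀ y c, ZFSet.pair y c ∈ f → c = F M y := by
    intro M hM f hf ha y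
    induction y using ZFSet.inductionOn with
    | _ y ih =>
      intro c hc
      obtain ⟨hy, hcM⟩ := hM.pair_of hf hc
      obtain ⟨h1, u, hu, h2, rfl⟩ := ha y hy c hcM hc
      refine (hF M hM y hy u hu fun d => ⟨fun hd => ?_, ?_⟩).symm
      · obtain ⟨z, hz, h⟩ := (h2 d (hM.tr _ hu hd)).1 hd
        exact ⟨z, hz, ih z hz _ h⟩
      · rintro ⟨z, hz, rfl⟩
        obtain ⟨d, hd, h⟩ := h1 z hz
        have := ih z hz _ h
        subst this
        exact (h2 _ hd).2 ⟨z, hz, h⟩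
  have A2 : ∀ M, Good M → ∀ f ∈ M, (∀ y c, ZFSet.pair y c ∈ f → c = F M y ∧ ∀ z ∈ y, ∃ d, ZFSet.pair z d ∈ f) → Att H M f := by
    intro M hM f hf ha y hy c hc h
    refine ⟨fun z hz => ?_, imgs f y, hM.imgs hf hy, fun d _ => mem_imgs, ?_⟩
    · obtain ⟨d, hd⟩ := (ha y c h).2 z hz
      exact ⟨d, (hM.pair_of hf hd).2, hd⟩
    · rw [(ha y c h).1]
      refine hF M hM y hy _ (hM.imgs hf hy) fun d => mem_imgs.trans ⟨?_, ?_⟩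
      · rintro ⟨z, hz, h⟩; exact ⟨z, hz, (ha _ _ h).1⟩
      · rintro ⟨z, hz, rfl⟩
        obtain ⟨d, hd⟩ := (ha y c h).2 z hz
        have := (ha _ _ hd).1
        subst this
        exact ⟨z, hz, hd⟩
  have A3 : ∀ M, Good M → ∀ f ∈ M, Att H M f → ∀ y c, ZFSet.pair y c ∈ f → ∀ z ∈ y, ZFSet.pair z (F M z) ∈ f := by
    intro M hM f hf ha y c h z hz
    obtain ⟨h1, -⟩ := ha y (hM.pair_of hf h).1 c (hM.pair_of hf h).2 h
    obtain ⟨d, hd, h⟩ := h1 z hz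
    rwa [← A1 M hM f hf ha z d h]
  have B : ∀ j, ∀ x, x ∈ N j → ∃ f ∈ N j, Att H (N j) f ∧ ZFSet.pair x (F (N j) x) ∈ f := by
    intro j
    have hM := hN.good j
    have hp' := hp ⟨N j, hM⟩ (hrep j)
    generalize N j = M at hM hp' ⊢
    intro x
    induction x using ZFSet.inductionOn with
    | _ x ih =>
    intro hx
    obtain ⟨B, hB, hB2⟩ := hp' Fin.elim0 (fun j => j.elim0) x hx (by
      rintro a b b' ha hb hb' hax ⟨h1, h2, h3⟩ ⟨h1', h2', h3'⟩
      exact subset_antisymm (h3 b' hb' h1' h2') (h3' b hb h1 h2))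
    have hB3 : ∀ f ∈ M, f ∈ B ↔ ∃ y ∈ M, y ∈ x ∧ Att H M f ∧ (∃ c, c ∈ M ∧ ZFSet.pair y c ∈ f) ∧ 
        ∀ g, g ∈ M → Att H M g → (∃ c, c ∈ M ∧ ZFSet.pair y c ∈ g) → f ⊆ g := hB2
    clear hB2
    have hB4 : ∀ f ∈ B, f ∈ M ∧ Att H M f := fun f hf => by
      obtain ⟨y, -, -, h, -⟩ := (hB3 f (hM.tr _ hB hf)).1 hf
      exact ⟨hM.tr _ hB hf, h⟩
    -- every y in x is in the domain of an element of B
    have hB5 : ∀ y ∈ x, ∃ f ∈ B, ZFSet.pair y (F M y) ∈ f := by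
      intro y hy
      have hyM := hM.tr _ hx hy
      obtain ⟨f0, hf0, h1, h2⟩ := ih y hy hyM
      let f := ZFSet.sep (fun w => ∀ g, g ∈ M → Att H M g → (∃ c, c ∈ M ∧ ZFSet.pair y c ∈ g) → w ∈ g) f0
      have hf : f ∈ M := by
        have d : DFun M0.{u} (n := 2) (fun i v => ZFSet.sep (fun w => ∀ g, g ∈ i.1 → Att H i.1 g → (∃ c, c ∈ i.1 ∧ ZFSet.pair (v 1) c ∈ g) → w ∈ g) (v 0)) := inferInstance
        exact d.mem ⟨M, hM⟩ ![f0, y] (fun j => by fin_cases j <;> assumption)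
      have hyf : ZFSet.pair y (F M y) ∈ f := by
        refine ZFSet.mem_sep.2 ⟨h2, fun g hg hag ⟨c, hc, h⟩ => ?_⟩
        rwa [← A1 M hM g hg hag _ _ h]
      have haf : Att H M f := by
        refine A2 M hM f hf fun y' c h => ⟨A1 M hM f0 hf0 h1 _ _ (ZFSet.mem_sep.1 h).1, fun z hz => ⟨F M z, ?_⟩⟩
        have h := ZFSet.mem_sep.1 h
        refine ZFSet.mem_sep.2 ⟨A3 M hM f0 hf0 h1 _ _ h.1 z hz, fun g hg hag hc => ?_⟩
        exact A3 M hM g hg hag _ _ (h.2 g hg hag hc) z hz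
      refine ⟨f, (hB3 f hf).2 ⟨y, hyM, hy, haf, ⟨_, (hM.pair_of hf hyf).2, hyf⟩, ?_⟩, hyf⟩
      intro g hg hag hc w hw
      exact (ZFSet.mem_sep.1 hw).2 g hg hag hc
    let g0 := ZFSet.sUnion B
    have hg0 : g0 ∈ M := hM.union _ hB
    have hg1 : ∀ y ∈ x, ZFSet.pair y (F M y) ∈ g0 := fun y hy => by
      obtain ⟨f, hf, h⟩ := hB5 y hy
      exact ZFSet.mem_sUnion.2 ⟨f, hf, h⟩
    have hg2 : ∀ y c, ZFSet.pair y c ∈ g0 → c = F M y ∧ ∀ z ∈ y, ZFSet.pair z (F M z) ∈ g0 := by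
      intro y c h
      obtain ⟨f, hf, h⟩ := ZFSet.mem_sUnion.1 h
      obtain ⟨hfM, haf⟩ := hB4 f hf
      exact ⟨A1 M hM f hfM haf _ _ h, fun z hz => ZFSet.mem_sUnion.2 ⟨f, hf, A3 M hM f hfM haf _ _ h z hz⟩⟩
    have hFx : F M x = H M (imgs g0 x) := by
      refine hF M hM x hx _ (hM.imgs hg0 hx) fun d => mem_imgs.trans ⟨?_, ?_⟩
      · rintro ⟨z, hz, h⟩; exact ⟨z, hz, (hg2 _ _ h).1⟩
      · rintro ⟨z, hz, rfl⟩
        exact ⟨z, hz, hg1 z hz⟩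
    have hFM : F M x ∈ M := by
      rw [hFx]; exact hH.mem ⟨M, hM⟩ ![imgs g0 x] (fun j => by fin_cases j; exact hM.imgs hg0 hx)
    have hfin : insert (ZFSet.pair x (F M x)) g0 ∈ M := hM.insert (hM.opair hx hFM) hg0
    refine ⟨_, hfin, A2 M hM _ hfin ?_, by simp⟩
    intro y c h
    rw [ZFSet.mem_insert_iff] at h
    rcases h with h | h
    · obtain ⟨rfl, rfl⟩ := ZFSet.pair_injective h
      exact ⟨rfl, fun z hz => ⟨F M z, ZFSet.mem_insert_iff.2 (Or.inr (hg1 z hz))⟩⟩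
    · obtain ⟨h1, h2⟩ := hg2 _ _ h
      exact ⟨h1, fun z hz => ⟨F M z, ZFSet.mem_insert_iff.2 (Or.inr (h2 z hz))⟩⟩
  have C : ∀ j, ∀ x, x ∈ N j → F (N j) x ∈ N j := fun j x hx => by
    obtain ⟨f, hf, -, h⟩ := B j x hx
    exact ((hN.good j).pair_of hf h).2
  refine ⟨fun j v hv => C j _ (hv 0), ?_⟩
  have hG' := hG.pull (fun j => ⟨N j, hN.good j⟩ : J → I0)
  refine Dfn.congr hG' fun j v hv => ⟨?_, ?_⟩
  · rintro ⟨f, hf, ha, h⟩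
    exact A1 _ (hN.good j) f hf ha _ _ h
  · intro h
    obtain ⟨f, hf, ha, h2⟩ := B j (v 0) (hv 0)
    refine ⟨f, hf, ha, ?_⟩
    have h' : v 1 = F (N j) (v 0) := h
    show ZFSet.pair (v 0) (v 1) ∈ f
    rw [h']; exact h2

end CtmForcing

namespace CtmForcing
open FirstOrder FirstOrder.Language
attribute [local instance] zfStruct
universe u w
set_option linter.all false

noncomputable def vf (M x : ZFSet.{u}) : ZFSet.{u} := ZFSet.sep (fun z => z.rank < x.rank) M

theorem mem_vf {M x z : ZFSet.{u}} : z ∈ vf M x ↔ z ∈ M ∧ z.rank < x.rank := ZFSet.mem_sep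

theorem sub_vf_iff {M x z : ZFSet.{u}} (hM : M.IsTransitive) (hz : z ∈ M) : z ⊆ vf M x ↔ z.rank ≤ x.rank := by
  rw [ZFSet.rank_le_iff]
  exact ⟨fun h y hy => (mem_vf.1 (h hy)).2, fun h y hy => mem_vf.2 ⟨hM _ hz hy, h hy⟩⟩

theorem sub_vf {M x : ZFSet.{u}} (hM : M.IsTransitive) (hx : x ∈ M) : x ⊆ vf M x := (sub_vf_iff hM hx).2 le_rfl

theorem vf_trans {M x : ZFSet.{u}} (hM : M.IsTransitive) : (vf M x).IsTransitive := by
  intro y hy z hz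
  have h := mem_vf.1 hy
  exact mem_vf.2 ⟨hM _ h.1 hz, (ZFSet.rank_lt_of_mem hz).trans h.2⟩

def one : ZFSet.{u} := ZFSet.pair ∅ ∅

noncomputable def chk (x : ZFSet.{u}) : ZFSet.{u} :=
  ZFSet.range (fun y : x => ZFSet.pair (chk y.1) one)
termination_by x
decreasing_by exact y.2

theorem mem_chk {x z : ZFSet.{u}} : z ∈ chk x ↔ ∃ y ∈ x, z = ZFSet.pair (chk y) one := by
  rw [chk, ZFSet.mem_range]
  constructor
  · rintro ⟨y, rfl⟩; exact ⟨y.1, y.2, rfl⟩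
  · rintro ⟨y, hy, rfl⟩; exact ⟨⟨y, hy⟩, rfl⟩

class VF {I : Type w} (M : I → ZFSet.{u}) : Prop extends GF M where
  vf1 : DFun M (n := 1) (fun i v => vf (M i) (v 0))
  chk1 : DFun M (n := 1) (fun i v => chk (v 0))

theorem exists_vf : ∃ p q : Σ n, BF (n+2), ∀ {J : Type w} (N : J → ZFSet.{u}) [GF N],
    (∀ j, Sentence.Realize {x // x ∈ N j} (replAx p.2)) → (∀ j, Sentence.Realize {x // x ∈ N j} (replAx q.2)) → VF N := by
  have h1 : DFun M0.{u} (n := 1) (fun i v => ZFSet.sep (fun z => ∃ w, w ∈ v 0 ∧ z ⊆ w) i.1) := by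
    refine DFun.of_mem (fun i v z => ∃ w, w ∈ v 0 ∧ z ⊆ w) (fun i v hv => ?_) (fun i v hv z hz => ?_)
    · have d : DFun M0.{u} (n := 1) (fun i v => ZFSet.sep (fun z => ∃ w, w ∈ v 0 ∧ z ⊆ w) (powM i.1 (ZFSet.sUnion (v 0)))) := inferInstance
      have := d.mem i v hv
      convert this using 1
      ext z
      rw [ZFSet.mem_sep, ZFSet.mem_sep, mem_powM]
      constructor
      · rintro ⟨h, w, hw, hz⟩
        exact ⟨⟨h, fun y hy => ZFSet.mem_sUnion.2 ⟨w, hw, hz hy⟩⟩, w, hw, hz⟩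
      · rintro ⟨h, h2⟩; exact ⟨h.1, h2⟩
    · rw [ZFSet.mem_sep]; exact ⟨fun h => h.2, fun h => ⟨hz, h⟩⟩
  obtain ⟨p, hp⟩ := recursion (fun M u => ZFSet.sep (fun z => ∃ w, w ∈ u ∧ z ⊆ w) M) vf h1 (by
    intro M hM x hx u hu h
    ext z
    rw [mem_vf, ZFSet.mem_sep]
    refine and_congr_right fun hz => ?_
    rw [ZFSet.lt_rank_iff]
    constructor
    · rintro ⟨y, hy, hr⟩
      exact ⟨vf M y, (h _).2 ⟨y, hy, rfl⟩, (sub_vf_iff hM.tr hz).2 hr⟩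
    · rintro ⟨w, hw, hzw⟩
      obtain ⟨y, hy, rfl⟩ := (h _).1 hw
      exact ⟨y, hy, (sub_vf_iff hM.tr hz).1 hzw⟩)
  have h2 : DFun M0.{u} (n := 1) (fun i v => ZFSet.prod (v 0) {one}) := by
    unfold one; infer_instance
  obtain ⟨q, hq⟩ := recursion (fun M u => ZFSet.prod u {one}) (fun M x => chk x) h2 (by
    intro M hM x hx u hu h
    ext z
    rw [mem_chk, ZFSet.mem_prod]
    constructor
    · rintro ⟨y, hy, rfl⟩
      exact ⟨chk y, (h _).2 ⟨y, hy, rfl⟩, one, by simp, rfl⟩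
    · rintro ⟨a, ha, b, hb, rfl⟩
      obtain ⟨y, hy, rfl⟩ := (h a).1 ha
      simp at hb
      exact ⟨y, hy, by rw [hb]⟩)
  exact ⟨p, q, fun {J} N _ h1 h2 => ⟨hp N h1, hq N h2⟩⟩

section
variable {I : Type w} {M : I → ZFSet.{u}} {n : ℕ}

instance DFun.one [GF M] : DFun M (n := n) (fun _ _ => one) := by
  unfold CtmForcing.one; infer_instance

instance DFun.vf [hM : VF M] {t : I → (Fin n → ZFSet.{u}) → ZFSet.{u}} [ht : DFun M t] : DFun M (fun i v => vf (M i) (t i v)) :=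
  hM.vf1.comp (fun _ => t)

instance DFun.chk [hM : VF M] {t : I → (Fin n → ZFSet.{u}) → ZFSet.{u}} [ht : DFun M t] : DFun M (fun i v => chk (t i v)) :=
  hM.chk1.comp (fun _ => t)

theorem VF.vf_mem [hM : VF M] {i : I} {x : ZFSet.{u}} (hx : x ∈ M i) : CtmForcing.vf (M i) x ∈ M i := hM.vf1.mem i ![x] (fun j => by fin_cases j; exact hx)

theorem VF.chk_mem [hM : VF M] {i : I} {x : ZFSet.{u}} (hx : x ∈ M i) : CtmForcing.chk x ∈ M i := hM.chk1.mem i ![x] (fun j => by fin_cases j; exact hx)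

end

end CtmForcing

namespace CtmForcing
open FirstOrder FirstOrder.Language
attribute [local instance] zfStruct
universe u w
set_option linter.all false

structure IsPo (M P L : ZFSet.{u}) : Prop where
  hP : P ∈ M
  hL : L ∈ M
  dom : ∀ q p, ZFSet.pair q p ∈ L → q ∈ P ∧ p ∈ P
  refl : ∀ p ∈ P, ZFSet.pair p p ∈ L
  trans : ∀ r q p, ZFSet.pair r q ∈ L → ZFSet.pair q p ∈ L → ZFSet.pair r p ∈ L
  one_mem : one ∈ P
  top : ∀ p ∈ P, ZFSet.pair p one ∈ L
  split : ∀ p ∈ P, ∃ q r, ZFSet.pair q p ∈ L ∧ ZFSet.pair r p ∈ L ∧ ∀ s, ¬ (ZFSet.pair s q ∈ L ∧ ZFSet.pair s r ∈ L)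

theorem exists_po {M : ZFSet.{u}} (hM : Good M) : ∃ P L, IsPo M P L := by
  have : Fact (Good M) := ⟨hM⟩
  obtain ⟨A, hA, h0, hs⟩ := hM.inf
  have hAc : Cst (fun _ : Unit => M) (fun _ => A) := ⟨fun _ => hA⟩
  let P : ZFSet.{u} := ZFSet.sep (fun z => ∃ x, x ∈ A ∧ ∃ a, a ∈ M ∧ a ⊆ x ∧ z = ZFSet.pair x a) (ZFSet.prod A (powM M (ZFSet.sUnion A)))
  have hP : P ∈ M := by
    have d : DFun (fun _ : Unit => M) (n := 0) (fun _ _ => ZFSet.sep (fun z => ∃ x, x ∈ A ∧ ∃ a, a ∈ M ∧ a ⊆ x ∧ z = ZFSet.pair x a) (ZFSet.prod A (powM M (ZFSet.sUnion A)))) := inferInstance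
    exact d.mem () Fin.elim0 (fun j => j.elim0)
  have mP : ∀ x a, ZFSet.pair x a ∈ P ↔ x ∈ A ∧ a ∈ M ∧ a ⊆ x := by
    intro x a
    rw [ZFSet.mem_sep]
    constructor
    · rintro ⟨-, x', hx, a', ha, h, e⟩
      obtain ⟨rfl, rfl⟩ := ZFSet.pair_injective e
      exact ⟨hx, ha, h⟩
    · rintro ⟨hx, ha, h⟩
      refine ⟨?_, x, hx, a, ha, h, rfl⟩
      rw [ZFSet.pair_mem_prod, mem_powM]
      exact ⟨hx, ha, fun y hy => ZFSet.mem_sUnion.2 ⟨x, hx, h hy⟩⟩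
  have mP2 : ∀ p ∈ P, ∃ x a, p = ZFSet.pair x a ∧ x ∈ A ∧ a ∈ M ∧ a ⊆ x := by
    intro p hp
    obtain ⟨-, x, hx, a, ha, h, rfl⟩ := ZFSet.mem_sep.1 hp
    exact ⟨x, a, rfl, hx, ha, h⟩
  have hPc : Cst (fun _ : Unit => M) (fun _ => P) := ⟨fun _ => hP⟩
  let L : ZFSet.{u} := ZFSet.sep (fun w => ∃ y, y ∈ M ∧ ∃ b, b ∈ M ∧ ∃ x, x ∈ M ∧ ∃ a, a ∈ M ∧ w = ZFSet.pair (ZFSet.pair y b) (ZFSet.pair x a) ∧ x ⊆ y ∧ b ∩ x = a) (ZFSet.prod P P)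
  have hL : L ∈ M := by
    have d : DFun (fun _ : Unit => M) (n := 0) (fun _ _ => ZFSet.sep (fun w => ∃ y, y ∈ M ∧ ∃ b, b ∈ M ∧ ∃ x, x ∈ M ∧ ∃ a, a ∈ M ∧ w = ZFSet.pair (ZFSet.pair y b) (ZFSet.pair x a) ∧ x ⊆ y ∧ b ∩ x = a) (ZFSet.prod P P)) := inferInstance
    exact d.mem () Fin.elim0 (fun j => j.elim0)
  have mL : ∀ y b x a, ZFSet.pair (ZFSet.pair y b) (ZFSet.pair x a) ∈ L ↔ ZFSet.pair y b ∈ P ∧ ZFSet.pair x a ∈ P ∧ x ⊆ y ∧ b ∩ x = a := by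
    intro y b x a
    rw [ZFSet.mem_sep, ZFSet.pair_mem_prod]
    constructor
    · rintro ⟨⟨h1, h2⟩, y', _, b', _, x', _, a', _, e, h⟩
      obtain ⟨e1, e2⟩ := ZFSet.pair_injective e
      obtain ⟨rfl, rfl⟩ := ZFSet.pair_injective e1
      obtain ⟨rfl, rfl⟩ := ZFSet.pair_injective e2
      exact ⟨h1, h2, h⟩
    · rintro ⟨h1, h2, h⟩
      have m1 := mem_of_pair (g := ∅) hM (hM.tr _ hP h1)
      have m2 := mem_of_pair (g := ∅) hM (hM.tr _ hP h2)
      exact ⟨⟨h1, h2⟩, y, m1.1, b, m1.2, x, m2.1, a, m2.2, rfl, h⟩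
  have dL : ∀ q p, ZFSet.pair q p ∈ L → q ∈ P ∧ p ∈ P := fun q p h => ZFSet.pair_mem_prod.1 (ZFSet.mem_sep.1 h).1
  refine ⟨P, L, hP, hL, dL, ?_, ?_, ?_, ?_, ?_⟩
  · intro p hp
    obtain ⟨x, a, rfl, hx, ha, h⟩ := mP2 p hp
    refine (mL _ _ _ _).2 ⟨hp, hp, fun _ h => h, ?_⟩
    ext z; rw [ZFSet.mem_inter]; exact ⟨fun h => h.1, fun hz => ⟨hz, h hz⟩⟩
  · intro r q p h1 h2
    obtain ⟨z, c, rfl, -⟩ := mP2 r (dL _ _ h1).1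
    obtain ⟨y, b, rfl, -⟩ := mP2 q (dL _ _ h2).1
    obtain ⟨x, a, rfl, -⟩ := mP2 p (dL _ _ h2).2
    obtain ⟨a1, a2, a3, a4⟩ := (mL _ _ _ _).1 h1
    obtain ⟨b1, b2, b3, b4⟩ := (mL _ _ _ _).1 h2
    refine (mL _ _ _ _).2 ⟨a1, b2, fun _ h => a3 (b3 h), ?_⟩
    rw [← b4, ← a4]
    ext w; simp only [ZFSet.mem_inter]
    exact ⟨fun h => ⟨⟨h.1, b3 h.2⟩, h.2⟩, fun h => ⟨h.1.1, h.2⟩⟩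
  · exact (mP _ _).2 ⟨h0, hM.empty, fun _ h => h⟩
  · intro p hp
    obtain ⟨x, a, rfl, hx, ha, h⟩ := mP2 p hp
    refine (mL _ _ _ _).2 ⟨hp, (mP _ _).2 ⟨h0, hM.empty, fun _ h => h⟩, ZFSet.empty_subset _, ?_⟩
    ext w; simp
  · intro p hp
    obtain ⟨x, a, rfl, hx, ha, h⟩ := mP2 p hp
    have hxM := hM.tr _ hA hx
    have hxa : x ∉ a := fun hh => ZFSet.mem_irrefl _ (h hh)
    refine ⟨ZFSet.pair (insert x x) a, ZFSet.pair (insert x x) (insert x a), ?_, ?_, ?_⟩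
    · refine (mL _ _ _ _).2 ⟨(mP _ _).2 ⟨hs x hx, ha, fun z hz => ZFSet.mem_insert_iff.2 (Or.inr (h hz))⟩, hp, 
        fun z hz => ZFSet.mem_insert_iff.2 (Or.inr hz), ?_⟩
      ext z; rw [ZFSet.mem_inter]; exact ⟨fun h => h.1, fun hz => ⟨hz, h hz⟩⟩
    · refine (mL _ _ _ _).2 ⟨(mP _ _).2 ⟨hs x hx, hM.insert hxM ha, ?_⟩, hp, 
        fun z hz => ZFSet.mem_insert_iff.2 (Or.inr hz), ?_⟩
      · intro z hz
        rw [ZFSet.mem_insert_iff] at hz ⊢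
        exact hz.imp id (fun hz => h hz)
      · ext z; rw [ZFSet.mem_inter, ZFSet.mem_insert_iff]
        constructor
        · rintro ⟨rfl | hz, h2⟩
          · exact absurd h2 (ZFSet.mem_irrefl _)
          · exact hz
        · exact fun hz => ⟨Or.inr hz, h hz⟩
    · rintro s ⟨h1, h2⟩
      obtain ⟨z, c, rfl, -⟩ := mP2 s (dL _ _ h1).1
      obtain ⟨-, -, -, e1⟩ := (mL _ _ _ _).1 h1
      obtain ⟨-, -, -, e2⟩ := (mL _ _ _ _).1 h2
      apply hxa
      rw [← e1, e2]; simp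

open Classical in
noncomputable def Po (M : ZFSet.{u}) : ZFSet.{u} := if h : Good M then (exists_po h).choose else ∅
open Classical in
noncomputable def Lo (M : ZFSet.{u}) : ZFSet.{u} := if h : Good M then (exists_po h).choose_spec.choose else ∅

theorem isPo {M : ZFSet.{u}} (h : Good M) : IsPo M (Po M) (Lo M) := by
  unfold Po Lo
  rw [dif_pos h, dif_pos h]
  exact (exists_po h).choose_spec.choose_spec

/-- the order -/
def le (M q p : ZFSet.{u}) : Prop := ZFSet.pair q p ∈ Lo M

section
variable {I : Type w} {M : I → ZFSet.{u}} {n : ℕ} [hM : GF M]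

instance : Cst M (fun i => Po (M i)) := ⟨fun i => (isPo (hM.good i)).hP⟩
instance : Cst M (fun i => Lo (M i)) := ⟨fun i => (isPo (hM.good i)).hL⟩

instance Dfn.le {s t : I → (Fin n → ZFSet.{u}) → ZFSet.{u}} [hs : DFun M s] [ht : DFun M t] :
    Dfn M (fun i v => le (M i) (s i v) (t i v)) := by
  unfold CtmForcing.le; infer_instance
end

section
variable {M : ZFSet.{u}} (hM : Good M)
include hM
theorem le_refl' {p : ZFSet.{u}} (hp : p ∈ Po M) : le M p p := (isPo hM).refl p hp
theorem le_trans' {r q p : ZFSet.{u}} (h : le M r q) (h2 : le M q p) : le M r p := (isPo hM).trans r q p h h2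
theorem le_dom {q p : ZFSet.{u}} (h : le M q p) : q ∈ Po M := ((isPo hM).dom q p h).1
theorem le_dom2 {q p : ZFSet.{u}} (h : le M q p) : p ∈ Po M := ((isPo hM).dom q p h).2
theorem Po_mem {p : ZFSet.{u}} (h : p ∈ Po M) : p ∈ M := hM.tr _ (isPo hM).hP h
theorem le_memM {q p : ZFSet.{u}} (h : le M q p) : q ∈ M := Po_mem hM (le_dom hM h)
end

/-- generic filters -/
structure Gen (M : ZFSet.{u}) (G : Set ZFSet.{u}) : Prop where
  sub : ∀ p ∈ G, p ∈ Po M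
  up : ∀ p ∈ G, ∀ q, le M p q → q ∈ G
  dir : ∀ p ∈ G, ∀ q ∈ G, ∃ r ∈ G, le M r p ∧ le M r q
  one : one ∈ G
  meet : ∀ D ∈ M, (∀ p ∈ Po M, ∃ q ∈ D, le M q p) → ∃ q ∈ G, q ∈ D

theorem exists_gen {M : ZFSet.{u}} (hM : Good M) (hc : M.toSet.Countable) : ∃ G, Gen M G := by
  -- enumerate M
  have hne : M.toSet.Nonempty := ⟨∅, hM.empty⟩
  obtain ⟨f, hf⟩ := hc.exists_eq_range hne
  have hex : ∀ (D p : ZFSet.{u}), ∃ q, p ∈ Po M → (le M q p ∧ ((∀ p ∈ Po M, ∃ q ∈ D, le M q p) → q ∈ D)) := by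
    intro D p
    by_cases hp : p ∈ Po M
    · by_cases hD : ∀ p ∈ Po M, ∃ q ∈ D, le M q p
      · obtain ⟨q, h1, h2⟩ := hD p hp
        exact ⟨q, fun _ => ⟨h2, fun _ => h1⟩⟩
      · exact ⟨p, fun _ => ⟨le_refl' hM hp, fun h => absurd h hD⟩⟩
    · exact ⟨p, fun h => absurd h hp⟩
  choose g hg using hex
  obtain ⟨s, hs0, hs1⟩ : ∃ s : ℕ → ZFSet.{u}, s 0 = one ∧ ∀ n, s (n+1) = g (f n) (s n) := ⟨fun n => Nat.rec one (fun n p => g (f n) p) n, rfl, fun _ => rfl⟩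
  have hsP : ∀ n, s n ∈ Po M := by
    intro n
    induction n with
    | zero => rw [hs0]; exact (isPo hM).one_mem
    | succ n ih => rw [hs1]; exact le_dom hM (hg _ _ ih).1
  have hmono : ∀ m n, m ≤ n → le M (s n) (s m) := by
    intro m n h
    induction n, h using Nat.le_induction with
    | base => exact le_refl' hM (hsP _)
    | succ n h ih => rw [hs1]; exact le_trans' hM (hg _ _ (hsP n)).1 ih
  refine ⟨{p | ∃ n, le M (s n) p}, ⟨?_, ?_, ?_, ?_, ?_⟩⟩
  · rintro p ⟨n, h⟩; exact le_dom2 hM h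
  · rintro p ⟨n, h⟩ q hq; exact ⟨n, le_trans' hM h hq⟩
  · rintro p ⟨m, hm⟩ q ⟨n, hn⟩
    refine ⟨s (max m n), ⟨max m n, le_refl' hM (hsP (max m n))⟩, le_trans' hM (hmono _ _ (le_max_left _ _)) hm, le_trans' hM (hmono _ _ (le_max_right _ _)) hn⟩
  · exact ⟨0, by rw [hs0]; exact le_refl' hM (isPo hM).one_mem⟩
  · intro D hD hd
    have : D ∈ M.toSet := hD
    rw [hf] at this
    obtain ⟨n, rfl⟩ := this
    exact ⟨s (n+1), ⟨n+1, le_refl' hM (hsP (n+1))⟩, by rw [hs1]; exact (hg _ _ (hsP n)).2 hd⟩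

/-- genericity for definable sets dense below a condition -/
theorem Gen.below {I : Type w} {M : I → ZFSet.{u}} {n : ℕ} [hM : GF M] {i : I} {G : Set ZFSet.{u}} (hG : Gen (M i) G)
    (Q : I → (Fin n → ZFSet.{u}) → ZFSet.{u} → Prop)
    [hQ : Dfn M (n := n + 1) (fun i w => Q i (fun j => w j.castSucc) (w (Fin.last n)))] 
    (v : Fin n → ZFSet.{u}) (hv : ∀ j, v j ∈ M i) {p : ZFSet.{u}} (hp : p ∈ G)
    (hd : ∀ q, le (M i) q p → ∃ r, le (M i) r q ∧ Q i v r) : ∃ r ∈ G, le (M i) r p ∧ Q i v r := by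
  have g := hM.good i
  have hpP := hG.sub p hp
  have hpM := Po_mem g hpP
  have d1 : Dfn M (n := n + 1 + 1) (fun i w => Q i (fun j => w j.castSucc.castSucc) (w (Fin.last (n+1)))) := by
    have := hQ.rename (Fin.snoc (fun j => j.castSucc.castSucc) (Fin.last (n+1)) : Fin (n+1) → Fin (n+2))
    simpa only [Fin.snoc_last, Fin.snoc_castSucc] using this
  have d : DFun M (n := n + 1) (fun i v => ZFSet.sep (fun r => (le (M i) r (v (Fin.last n)) ∧ Q i (fun j => v j.castSucc) r) ∨ ¬ ∃ s, s ∈ Po (M i) ∧ le (M i) s r ∧ le (M i) s (v (Fin.last n))) (Po (M i))) := inferInstance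
  have hD := d.mem i (Fin.snoc v p) (fun j => by refine Fin.lastCases ?_ (fun j => ?_) j <;> simp [hpM, hv])
  simp only [Fin.snoc_last, Fin.snoc_castSucc] at hD
  obtain ⟨r, hrG, hr⟩ := hG.meet _ hD (by
    intro q hq
    by_cases h : ∃ s, s ∈ Po (M i) ∧ le (M i) s q ∧ le (M i) s p
    · obtain ⟨s, hs, h1, h2⟩ := h
      obtain ⟨r, hr, h3⟩ := hd s h2
      exact ⟨r, ZFSet.mem_sep.2 ⟨le_dom g hr, Or.inl ⟨le_trans' g hr h2, h3⟩⟩, le_trans' g hr h1⟩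
    · exact ⟨q, ZFSet.mem_sep.2 ⟨hq, Or.inr h⟩, le_refl' g hq⟩)
  obtain ⟨-, h | h⟩ := ZFSet.mem_sep.1 hr
  · exact ⟨r, hrG, h⟩
  · obtain ⟨s, hs, h1, h2⟩ := hG.dir r hrG p hp
    exact absurd ⟨s, hG.sub s hs, h1, h2⟩ h

end CtmForcing

namespace CtmForcing
open FirstOrder FirstOrder.Language
attribute [local instance] zfStruct
universe u w
set_option linter.all false

theorem rank_lt_of_pair_mem {x y z : ZFSet.{u}} (h : ZFSet.pair x y ∈ z) : x.rank < z.rank := by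
  have h1 : x ∈ ({x} : ZFSet.{u}) := by simp
  have h2 : ({x} : ZFSet.{u}) ∈ ZFSet.pair x y := by simp [ZFSet.pair]
  exact (ZFSet.rank_lt_of_mem h1).trans ((ZFSet.rank_lt_of_mem h2).trans (ZFSet.rank_lt_of_mem h))

theorem mem_ssU {x y z : ZFSet.{u}} (h : ZFSet.pair x y ∈ z) : x ∈ ZFSet.sUnion (ZFSet.sUnion z) := by
  refine ZFSet.mem_sUnion.2 ⟨{x}, ZFSet.mem_sUnion.2 ⟨_, h, ?_⟩, ?_⟩ <;> simp [ZFSet.pair]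

theorem tr_pair {x y z T : ZFSet.{u}} (hT : T.IsTransitive) (hz : z ∈ T) (h : ZFSet.pair x y ∈ z) : x ∈ T := by
  have h1 : x ∈ ({x} : ZFSet.{u}) := by simp
  have h2 : ({x} : ZFSet.{u}) ∈ ZFSet.pair x y := by simp [ZFSet.pair]
  exact hT _ (hT _ (hT _ hz h) h2) h1

open Classical in
noncomputable def val (G : Set ZFSet.{u}) (τ : ZFSet.{u}) : ZFSet.{u} :=
  ZFSet.range (fun y : (ZFSet.sep (fun σ => ∃ p ∈ G, ZFSet.pair σ p ∈ τ) (ZFSet.sUnion (ZFSet.sUnion τ)) : ZFSet.{u}) => val G y.1)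
termination_by τ.rank
decreasing_by
  obtain ⟨-, p, -, h⟩ := ZFSet.mem_sep.1 y.2
  exact rank_lt_of_pair_mem h

theorem mem_val {G : Set ZFSet.{u}} {τ z : ZFSet.{u}} : z ∈ val G τ ↔ ∃ σ p, p ∈ G ∧ ZFSet.pair σ p ∈ τ ∧ z = val G σ := by
  rw [val, ZFSet.mem_range]
  constructor
  · rintro ⟨y, rfl⟩
    obtain ⟨-, p, hp, h⟩ := ZFSet.mem_sep.1 y.2
    exact ⟨y.1, p, hp, h, rfl⟩
  · rintro ⟨σ, p, hp, h, rfl⟩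
    exact ⟨⟨σ, ZFSet.mem_sep.2 ⟨mem_ssU h, p, hp, h⟩⟩, rfl⟩

theorem val_chk {G : Set ZFSet.{u}} (h1 : one ∈ G) (x : ZFSet.{u}) : val G (chk x) = x := by
  induction x using ZFSet.inductionOn with
  | _ x ih =>
    ext z
    rw [mem_val]
    constructor
    · rintro ⟨σ, p, hp, h, rfl⟩
      obtain ⟨y, hy, e⟩ := mem_chk.1 h
      obtain ⟨rfl, rfl⟩ := ZFSet.pair_injective e
      rwa [ih y hy]
    · intro hz
      exact ⟨chk z, one, h1, mem_chk.2 ⟨z, hz, rfl⟩, (ih z hz).symm⟩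

theorem rank_val {G : Set ZFSet.{u}} (τ : ZFSet.{u}) : (val G τ).rank ≤ τ.rank := by
  have : ∀ o, ∀ τ : ZFSet.{u}, τ.rank = o → (val G τ).rank ≤ τ.rank := by
    intro o
    induction o using WellFoundedLT.induction with
    | _ o ih =>
      rintro τ rfl
      rw [ZFSet.rank_le_iff]
      intro z hz
      obtain ⟨σ, p, hp, h, rfl⟩ := mem_val.1 hz
      exact (ih _ (rank_lt_of_pair_mem h) σ rfl).trans_lt (rank_lt_of_pair_mem h)
  exact this _ τ rfl

/-- half clause -/
def HC (M : ZFSet.{u}) (E : ZFSet.{u} → ZFSet.{u} → ZFSet.{u} → Prop) (q x y : ZFSet.{u}) : Prop :=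
  ∀ a, a ∈ M → ∀ r, r ∈ M → ZFSet.pair a r ∈ x → ∀ q', q' ∈ M → le M q' q → le M q' r →
    ∃ t, t ∈ M ∧ le M t q' ∧ ∃ b, b ∈ M ∧ ∃ s, s ∈ M ∧ ZFSet.pair b s ∈ y ∧ le M t s ∧ E t a b

def Bisim (M R : ZFSet.{u}) : Prop :=
  ∀ q, q ∈ M → ∀ x, x ∈ M → ∀ y, y ∈ M → ZFSet.pair q (ZFSet.pair x y) ∈ R →
    (∀ q', q' ∈ M → le M q' q → ZFSet.pair q' (ZFSet.pair x y) ∈ R) ∧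
    HC M (fun t a b => ZFSet.pair t (ZFSet.pair a b) ∈ R) q x y ∧
    HC M (fun t a b => ZFSet.pair t (ZFSet.pair b a) ∈ R) q y x

def EqF (M p x y : ZFSet.{u}) : Prop := ∃ R, R ∈ M ∧ Bisim M R ∧ ZFSet.pair p (ZFSet.pair x y) ∈ R

section
variable {I : Type w} {M : I → ZFSet.{u}} {n : ℕ} [hM : VF M]

set_option synthInstance.maxSize 100000 in
set_option synthInstance.maxHeartbeats 400000 in
instance Dfn.bisim {s : I → (Fin n → ZFSet.{u}) → ZFSet.{u}} [hs : DFun M s] :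
    Dfn M (fun i v => Bisim (M i) (s i v)) := by
  unfold CtmForcing.Bisim HC; beta_reduce; infer_instance

instance Dfn.eqF {p s t : I → (Fin n → ZFSet.{u}) → ZFSet.{u}} [hp : DFun M p] [hs : DFun M s] [ht : DFun M t] :
    Dfn M (fun i v => EqF (M i) (p i v) (s i v) (t i v)) := by
  unfold CtmForcing.EqF; infer_instance

variable {i : I} {p q x y : ZFSet.{u}}

theorem HC.mono {M : ZFSet.{u}} {E E' : ZFSet.{u} → ZFSet.{u} → ZFSet.{u} → Prop} {q x y : ZFSet.{u}} (h : HC M E q x y)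
    (hE : ∀ t a b r s, ZFSet.pair a r ∈ x → ZFSet.pair b s ∈ y → t ∈ M → a ∈ M → b ∈ M → le M t q → E t a b → E' t a b) (hM : Good M) : HC M E' q x y := by
  intro a ha r hr har q' hq' h1 h2
  obtain ⟨t, ht, h3, b, hb, s, hs, hbs, h4, h5⟩ := h a ha r hr har q' hq' h1 h2
  exact ⟨t, ht, h3, b, hb, s, hs, hbs, h4, hE _ _ _ _ _ har hbs ht ha hb (le_trans' hM h3 h1) h5⟩

theorem HC.le {M : ZFSet.{u}} {E : ZFSet.{u} → ZFSet.{u} → ZFSet.{u} → Prop} {q q0 x y : ZFSet.{u}} (h : HC M E q x y)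
    (hq : le M q0 q) (hM : Good M) : HC M E q0 x y := by
  intro a ha r hr har q' hq' h1 h2
  exact h a ha r hr har q' hq' (le_trans' hM h1 hq) h2

theorem EqF.mem {M p x y : ZFSet.{u}} (hM : Good M) (h : EqF M p x y) : p ∈ M ∧ x ∈ M ∧ y ∈ M := by
  obtain ⟨R, hR, hb, h⟩ := h
  have h1 := mem_of_pair (g := ∅) hM (hM.tr _ hR h)
  have h2 := mem_of_pair (g := ∅) hM h1.2
  exact ⟨h1.1, h2⟩

theorem EqF.mono {M p q x y : ZFSet.{u}} (hM : Good M) (h : EqF M p x y) (hq : le M q p) : EqF M q x y := by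
  have hm := h.mem hM
  obtain ⟨R, hR, hb, h⟩ := h
  exact ⟨R, hR, hb, (hb p hm.1 x hm.2.1 y hm.2.2 h).1 q (le_memM hM hq) hq⟩

theorem EqF.cl {M p x y : ZFSet.{u}} (hM : Good M) (h : EqF M p x y) : HC M (EqF M) p x y ∧ HC M (fun t a b => EqF M t b a) p y x := by
  have hm := h.mem hM
  obtain ⟨R, hR, hb, h⟩ := h
  have h2 := (hb p hm.1 x hm.2.1 y hm.2.2 h).2
  exact ⟨h2.1.mono (fun t a b r s _ _ _ _ _ _ h => ⟨R, hR, hb, h⟩) hM, h2.2.mono (fun t a b r s _ _ _ _ _ _ h => ⟨R, hR, hb, h⟩) hM⟩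

theorem EqF.of_cl (hp : p ∈ Po (M i)) (hx : x ∈ M i) (hy : y ∈ M i) 
    (h1 : HC (M i) (EqF (M i)) p x y) (h2 : HC (M i) (fun t a b => EqF (M i) t b a) p y x) : EqF (M i) p x y := by
  have g := hM.good i
  have hpM := Po_mem g hp
  have d : DFun M (n := 3) (fun i v => ZFSet.sep (fun z => ∃ q, q ∈ M i ∧ ∃ a, a ∈ M i ∧ ∃ b, b ∈ M i ∧ z = ZFSet.pair q (ZFSet.pair a b) ∧ 
    (EqF (M i) q a b ∨ (a = v 1 ∧ b = v 2 ∧ le (M i) q (v 0)))) (ZFSet.prod (Po (M i)) (ZFSet.prod (vf (M i) {v 1, v 2}) (vf (M i) {v 1, v 2})))) := inferInstance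
  have dm := d.mem i ![p, x, y] (by intro j; fin_cases j <;> assumption)
  set R := ZFSet.sep _ _ with hR
  clear_value R
  simp at hR
  set T := vf (M i) {x, y} with hT
  have tT : T.IsTransitive := vf_trans g.tr
  have hxT : x ∈ T := mem_vf.2 ⟨hx, ZFSet.rank_lt_of_mem (by simp)⟩
  have hyT : y ∈ T := mem_vf.2 ⟨hy, ZFSet.rank_lt_of_mem (by simp)⟩
  have mR : ∀ q a b, ZFSet.pair q (ZFSet.pair a b) ∈ R ↔ q ∈ Po (M i) ∧ a ∈ T ∧ b ∈ T ∧ (EqF (M i) q a b ∨ (a = x ∧ b = y ∧ le (M i) q p)) := by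
    intro q a b
    rw [hR, ZFSet.mem_sep, ZFSet.pair_mem_prod, ZFSet.pair_mem_prod]
    constructor
    · rintro ⟨⟨hq, ha, hb⟩, q', _, a', _, b', _, e, h⟩
      obtain ⟨rfl, e2⟩ := ZFSet.pair_injective e
      obtain ⟨rfl, rfl⟩ := ZFSet.pair_injective e2
      exact ⟨hq, ha, hb, h⟩
    · rintro ⟨hq, ha, hb, h⟩
      exact ⟨⟨hq, ha, hb⟩, q, Po_mem g hq, a, (mem_vf.1 ha).1, b, (mem_vf.1 hb).1, rfl, h⟩
  refine ⟨R, dm, ?_, (mR _ _ _).2 ⟨hp, hxT, hyT, Or.inr ⟨rfl, rfl, le_refl' g hp⟩⟩⟩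
  intro q hq a ha b hb hh
  obtain ⟨hqP, haT, hbT, h⟩ := (mR _ _ _).1 hh
  have hcl : HC (M i) (EqF (M i)) q a b ∧ HC (M i) (fun t a b => EqF (M i) t b a) q b a := by
    rcases h with h | ⟨rfl, rfl, h⟩
    · exact h.cl g
    · exact ⟨h1.le h g, h2.le h g⟩
  refine ⟨fun q' hq' hle => (mR _ _ _).2 ⟨le_dom g hle, haT, hbT, ?_⟩, hcl.1.mono ?_ g, hcl.2.mono ?_ g⟩
  · rcases h with h | ⟨h1, h2, h⟩
    · exact Or.inl (h.mono g hle)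
    · exact Or.inr ⟨h1, h2, le_trans' g hle h⟩
  · intro t a' b' r s h1 h2 ht ha' hb' hle h
    exact (mR _ _ _).2 ⟨le_dom g hle, tr_pair tT haT h1, tr_pair tT hbT h2, Or.inl h⟩
  · intro t a' b' r s h1 h2 ht ha' hb' hle h
    exact (mR _ _ _).2 ⟨le_dom g hle, tr_pair tT haT h2, tr_pair tT hbT h1, Or.inl h⟩

end

end CtmForcing

namespace CtmForcing
open FirstOrder FirstOrder.Language
attribute [local instance] zfStruct
universe u w
set_option linter.all false
set_option synthInstance.maxSize 100000
set_option synthInstance.maxHeartbeats 400000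

section
variable {I : Type w} {M : I → ZFSet.{u}} {n : ℕ} [hM : VF M] {i : I} {G : Set ZFSet.{u}} {p q x y : ZFSet.{u}}

theorem vec2 {M x y : ZFSet.{u}} (hx : x ∈ M) (hy : y ∈ M) : ∀ j, (![x, y] : Fin 2 → ZFSet.{u}) j ∈ M := by
  intro j; fin_cases j <;> assumption
theorem vec1 {M x : ZFSet.{u}} (hx : x ∈ M) : ∀ j, (![x] : Fin 1 → ZFSet.{u}) j ∈ M := by
  intro j; fin_cases j; assumption
theorem vec3 {M x y z : ZFSet.{u}} (hx : x ∈ M) (hy : y ∈ M) (hz : z ∈ M) : ∀ j, (![x, y, z] : Fin 3 → ZFSet.{u}) j ∈ M := by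
  intro j; fin_cases j <;> assumption

theorem hc_sub (hG : Gen (M i) G) (E : I → ZFSet.{u} → ZFSet.{u} → ZFSet.{u} → Prop)
    (hE : ∀ (n : ℕ) (r a b : I → (Fin n → ZFSet.{u}) → ZFSet.{u}) [DFun M r] [DFun M a] [DFun M b],
      Dfn M (fun i v => E i (r i v) (a i v) (b i v)))
    (hx : x ∈ M i) (hy : y ∈ M i) (hp : p ∈ G) (h : HC (M i) (E i) p x y)
    (hv : ∀ t a b r, t ∈ G → ZFSet.pair a r ∈ x → E i t a b → val G a = val G b) : val G x ⊆ val G y := by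
  have g := hM.good i
  intro z hz
  obtain ⟨a, r, hr, har, rfl⟩ := mem_val.1 hz
  obtain ⟨haM, hrM⟩ := mem_of_pair (g := ∅) g (g.tr _ hx har)
  obtain ⟨q, hq, hqp, hqr⟩ := hG.dir p hp r hr
  have hE' := hE (2+1+1+1) (fun i v => v 2) (fun i v => v 0) (fun i v => v 3)
  obtain ⟨t, ht, htq, b, hb, s, hs, hbs, hts, hab⟩ := hG.below (n := 2) (fun i v r => ∃ b, b ∈ M i ∧ ∃ s, s ∈ M i ∧ ZFSet.pair b s ∈ v 1 ∧ le (M i) r s ∧ E i r (v 0) b)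
    ![a, y] (vec2 haM hy) hq (by
      intro q' hq'
      obtain ⟨t, ht, h1, h2⟩ := h a haM r hrM har q' (le_memM g hq') (le_trans' g hq' hqp) (le_trans' g hq' hqr)
      exact ⟨t, h1, h2⟩)
  exact mem_val.2 ⟨b, s, hG.up t ht s hts, hbs, hv t a b r ht har hab⟩

theorem val_eq_of (hG : Gen (M i) G) (hp : p ∈ G) (h : EqF (M i) p x y) : val G x = val G y := by
  have g := hM.good i
  have : ∀ o, ∀ p x y, x.rank = o → p ∈ G → EqF (M i) p x y → val G x = val G y := by
    intro o
    induction o using WellFoundedLT.induction with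
    | _ o ih =>
      rintro p x y rfl hp h
      have hm := h.mem g
      have hc := h.cl g
      have s1 := hc_sub hG (fun i t a b => EqF (M i) t a b) (fun n r a b _ _ _ => inferInstance) hm.2.1 hm.2.2 hp hc.1 (by
        intro t a b r ht har h
        exact ih _ (rank_lt_of_pair_mem har) t a b rfl ht h)
      refine ZFSet.ext fun z => ⟨fun hz => s1 hz, fun hz => ?_⟩
      -- the second half, with rank bound on the other side
      obtain ⟨a, r, hr, har, rfl⟩ := mem_val.1 hz
      obtain ⟨haM, hrM⟩ := mem_of_pair (g := ∅) g (g.tr _ hm.2.2 har)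
      obtain ⟨q, hq, hqp, hqr⟩ := hG.dir p hp r hr
      obtain ⟨t, ht, htq, b, hb, s, hs, hbs, hts, hab⟩ := hG.below (n := 2) (fun i v r => ∃ b, b ∈ M i ∧ ∃ s, s ∈ M i ∧ ZFSet.pair b s ∈ v 1 ∧ le (M i) r s ∧ EqF (M i) r b (v 0))
        ![a, x] (vec2 haM hm.2.1) hq (by
          intro q' hq'
          obtain ⟨t, ht, h1, h2⟩ := hc.2 a haM r hrM har q' (le_memM g hq') (le_trans' g hq' hqp) (le_trans' g hq' hqr)
          exact ⟨t, h1, h2⟩)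
      exact mem_val.2 ⟨b, s, hG.up t ht s hts, hbs, (ih _ (rank_lt_of_pair_mem hbs) t b a rfl ht hab).symm⟩
  exact this _ p x y rfl hp h

/-- failure of a half clause -/
def NHC (M : ZFSet.{u}) (E : ZFSet.{u} → ZFSet.{u} → ZFSet.{u} → Prop) (q x y : ZFSet.{u}) : Prop :=
  ∃ a, a ∈ M ∧ ∃ r, r ∈ M ∧ ZFSet.pair a r ∈ x ∧ le M q r ∧
    ∀ t, t ∈ M → le M t q → ∀ b, b ∈ M → ∀ s, s ∈ M → ZFSet.pair b s ∈ y → le M t s → ¬ E t a b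

theorem NHC.of {M p x y : ZFSet.{u}} (g : Good M) {E : ZFSet.{u} → ZFSet.{u} → ZFSet.{u} → Prop} (h : ¬ HC M E p x y) : 
    ∃ q, le M q p ∧ NHC M E q x y := by
  unfold HC at h
  push Not at h
  obtain ⟨a, ha, r, hr, har, q, hq, h1, h2, h⟩ := h
  exact ⟨q, h1, a, ha, r, hr, har, h2, fun t ht htq b hb s hs hbs hts hE => h t ht htq b hb s hs hbs hts hE⟩

theorem EqF.of_val (hG : Gen (M i) G) (hx : x ∈ M i) (hy : y ∈ M i) (h : val G x = val G y) : ∃ p ∈ G, EqF (M i) p x y := by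
  have g := hM.good i
  have : ∀ o, ∀ x y, x.rank = o → x ∈ M i → y ∈ M i → val G x = val G y → ∃ p ∈ G, EqF (M i) p x y := by
    intro o
    induction o using WellFoundedLT.induction with
    | _ o ih =>
      rintro x y rfl hx hy h
      have e : Dfn M (n := 2 + 1) (fun i w => (fun (i : I) (v : Fin 2 → ZFSet.{u}) (r : ZFSet.{u}) => EqF (M i) r (v 0) (v 1) ∨ NHC (M i) (EqF (M i)) r (v 0) (v 1) ∨ NHC (M i) (fun t a b => EqF (M i) t b a) r (v 1) (v 0)) i (fun j => w j.castSucc) (w (Fin.last 2))) := by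
        unfold NHC; beta_reduce; infer_instance
      obtain ⟨p, hp, -, hd⟩ := hG.below (n := 2) (fun (i : I) (v : Fin 2 → ZFSet.{u}) (r : ZFSet.{u}) => EqF (M i) r (v 0) (v 1) ∨ NHC (M i) (EqF (M i)) r (v 0) (v 1) ∨ NHC (M i) (fun t a b => EqF (M i) t b a) r (v 1) (v 0))
        ![x, y] (vec2 hx hy) hG.one (by
          intro q hq
          by_cases h1 : HC (M i) (EqF (M i)) q x y
          · by_cases h2 : HC (M i) (fun t a b => EqF (M i) t b a) q y x
            · exact ⟨q, le_refl' g (le_dom g hq), Or.inl (EqF.of_cl (le_dom g hq) hx hy h1 h2)⟩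
            · obtain ⟨r, hr, h⟩ := NHC.of g h2
              exact ⟨r, hr, Or.inr (Or.inr h)⟩
          · obtain ⟨r, hr, h⟩ := NHC.of g h1
            exact ⟨r, hr, Or.inr (Or.inl h)⟩)
      rcases hd with hd | ⟨a, ha, r, hr, har, hpr, hn⟩ | ⟨a, ha, r, hr, har, hpr, hn⟩
      · exact ⟨p, hp, hd⟩
      · exfalso
        have hz : val G a ∈ val G x := mem_val.2 ⟨a, r, hG.up p hp r hpr, har, rfl⟩
        rw [h] at hz
        obtain ⟨b, s, hs, hbs, hab⟩ := mem_val.1 hz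
        have hb := mem_of_pair (g := ∅) g (g.tr _ hy hbs)
        obtain ⟨q, hq, hE⟩ := ih _ (rank_lt_of_pair_mem har) a b rfl ha hb.1 hab
        obtain ⟨t, ht, h1, h2⟩ := hG.dir p hp q hq
        obtain ⟨t', ht', h1', h2'⟩ := hG.dir t ht s hs
        exact hn t' (le_memM g h1') (le_trans' g h1' h1) b hb.1 s hb.2 hbs h2' (hE.mono g (le_trans' g h1' h2))
      · exfalso
        have hz : val G a ∈ val G y := mem_val.2 ⟨a, r, hG.up p hp r hpr, har, rfl⟩
        rw [← h] at hz
        obtain ⟨b, s, hs, hbs, hab⟩ := mem_val.1 hz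
        have hb := mem_of_pair (g := ∅) g (g.tr _ hx hbs)
        obtain ⟨q, hq, hE⟩ := ih _ (rank_lt_of_pair_mem hbs) b a rfl hb.1 ha hab.symm
        obtain ⟨t, ht, h1, h2⟩ := hG.dir p hp q hq
        obtain ⟨t', ht', h1', h2'⟩ := hG.dir t ht s hs
        exact hn t' (le_memM g h1') (le_trans' g h1' h1) b hb.1 s hb.2 hbs h2' (hE.mono g (le_trans' g h1' h2))
  exact this _ x y rfl hx hy h

theorem eqF_truth (hG : Gen (M i) G) (hx : x ∈ M i) (hy : y ∈ M i) : val G x = val G y ↔ ∃ p ∈ G, EqF (M i) p x y :=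
  ⟨EqF.of_val hG hx hy, fun ⟨p, hp, h⟩ => val_eq_of hG hp h⟩

/-- forcing membership -/
def MemF (M p x y : ZFSet.{u}) : Prop := ∀ q, q ∈ M → le M q p → ∃ r, r ∈ M ∧ le M r q ∧ ∃ b, b ∈ M ∧ ∃ s, s ∈ M ∧ ZFSet.pair b s ∈ y ∧ le M r s ∧ EqF M r x b

instance Dfn.memF {p s t : I → (Fin n → ZFSet.{u}) → ZFSet.{u}} [hp : DFun M p] [hs : DFun M s] [ht : DFun M t] :
    Dfn M (fun i v => MemF (M i) (p i v) (s i v) (t i v)) := by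
  unfold CtmForcing.MemF; infer_instance

theorem MemF.mono {M p q x y : ZFSet.{u}} (hM : Good M) (h : MemF M p x y) (hq : le M q p) : MemF M q x y :=
  fun r hr hrq => h r hr (le_trans' hM hrq hq)

theorem memF_truth (hG : Gen (M i) G) (hx : x ∈ M i) (hy : y ∈ M i) : val G x ∈ val G y ↔ ∃ p ∈ G, MemF (M i) p x y := by
  have g := hM.good i
  constructor
  · intro h
    obtain ⟨b, s, hs, hbs, hab⟩ := mem_val.1 h
    have hb := mem_of_pair (g := ∅) g (g.tr _ hy hbs)
    obtain ⟨q, hq, hE⟩ := EqF.of_val hG hx hb.1 hab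
    obtain ⟨t, ht, h1, h2⟩ := hG.dir q hq s hs
    exact ⟨t, ht, fun r hr hrt => ⟨r, hr, le_refl' g (le_dom g hrt), b, hb.1, s, hb.2, hbs, le_trans' g hrt h2, hE.mono g (le_trans' g hrt h1)⟩⟩
  · rintro ⟨p, hp, h⟩
    obtain ⟨t, ht, htq, b, hb, s, hs, hbs, hts, hab⟩ := hG.below (n := 2) (fun i v r => ∃ b, b ∈ M i ∧ ∃ s, s ∈ M i ∧ ZFSet.pair b s ∈ v 1 ∧ le (M i) r s ∧ EqF (M i) r (v 0) b)
        ![x, y] (vec2 hx hy) hp (by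
          intro q hq
          obtain ⟨t, ht, h1, h2⟩ := h q (le_memM g hq) hq
          exact ⟨t, h1, h2⟩)
    exact mem_val.2 ⟨b, s, hG.up t ht s hts, hbs, val_eq_of hG ht hab⟩

end

end CtmForcing

namespace CtmForcing
open FirstOrder FirstOrder.Language
attribute [local instance] zfStruct
universe u w
set_option linter.all false
set_option synthInstance.maxSize 100000
set_option synthInstance.maxHeartbeats 400000

def tix {n : ℕ} : SetLang.Term (Empty ⊕ Fin n) → Fin n
  | .var (.inl e) => e.elim
  | .var (.inr i) => i
  | .func f _ => f.elim

theorem tix_spec {n : ℕ} (t : SetLang.Term (Empty ⊕ Fin n)) : t = Term.var (Sum.inr (tix t)) := by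
  cases t with
  | var x => rcases x with e | i
             · exact e.elim
             · rfl
  | func f _ => exact f.elim

def relF (M : ZFSet.{u}) (p : ZFSet.{u}) : {l : ℕ} → memRel l → (Fin l → ZFSet.{u}) → Prop
  | _, .mem => fun w => MemF M p (w 0) (w 1)

def Forces (M : ZFSet.{u}) : {n : ℕ} → BF n → ZFSet.{u} → (Fin n → ZFSet.{u}) → Prop
  | _, .falsum => fun _ _ => False
  | _, .equal s t => fun p v => EqF M p (v (tix s)) (v (tix t))
  | _, .rel R ts => fun p v => relF M p R (fun j => v (tix (ts j)))
  | _, .imp φ ψ => fun p v => ∀ q, q ∈ M → le M q p → Forces M φ q v → ∃ r, r ∈ M ∧ le M r q ∧ Forces M ψ r v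
  | n, .all φ => fun p v => ∀ τ, τ ∈ M → ∀ q, q ∈ M → le M q p → ∃ r, r ∈ M ∧ le M r q ∧ Forces M φ r (Fin.snoc v τ : Fin (n+1) → ZFSet.{u})

theorem Forces.mono {M : ZFSet.{u}} (hM : Good M) {n : ℕ} {φ : BF n} {p q : ZFSet.{u}} {v : Fin n → ZFSet.{u}} (h : Forces M φ p v)
    (hq : le M q p) : Forces M φ q v := by
  cases φ with
  | falsum => exact h
  | equal s t => unfold Forces at h ⊢; exact h.mono hM hq
  | rel R ts => 
    cases R
    unfold Forces relF at h ⊢; exact MemF.mono hM h hq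
  | imp φ ψ => 
    unfold Forces at h ⊢
    intro r hr hrq
    exact h r hr (le_trans' hM hrq hq)
  | all φ =>
    unfold Forces at h ⊢
    intro τ hτ r hr hrq
    exact h τ hτ r hr (le_trans' hM hrq hq)

section
variable {I : Type w} {M : I → ZFSet.{u}} [hM : VF M]

instance Dfn.forces {n : ℕ} (φ : BF n) : ∀ {k : ℕ} (p : I → (Fin k → ZFSet.{u}) → ZFSet.{u})
    (s : Fin n → I → (Fin k → ZFSet.{u}) → ZFSet.{u}) [hp : DFun M p] [hs : ∀ j, DFun M (s j)],
    Dfn M (fun i v => Forces (M i) φ (p i v) (fun j => s j i v)) := by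
  induction φ with
  | falsum => intro k p s _ _; unfold Forces; infer_instance
  | equal a b => intro k p s _ _; unfold Forces; beta_reduce; infer_instance
  | rel R ts => intro k p s _ _; cases R; unfold Forces relF; beta_reduce; infer_instance
  | imp φ ψ h1 h2 => intro k p s _ _; unfold Forces; infer_instance
  | @all n φ h => 
    intro k p s _ _; unfold Forces
    have := @h (k+1+1+1) (fun i v => v (Fin.last _)) 
       (fun j i v => (Fin.snoc (fun j => s j i (fun j => v j.castSucc.castSucc.castSucc)) (v (Fin.last k).castSucc.castSucc) : Fin (n+1) → ZFSet.{u}) j) _ 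
       (DFun.snocs (fun j i v => s j i (fun j => v j.castSucc.castSucc.castSucc)) (fun i v => v (Fin.last k).castSucc.castSucc))
    infer_instance

/-- the extension -/
noncomputable def ext (M : ZFSet.{u}) (G : Set ZFSet.{u}) : ZFSet.{u} := ZFSet.range (fun τ : M => val G τ.1)

theorem mem_ext {M : ZFSet.{u}} {G : Set ZFSet.{u}} {z : ZFSet.{u}} : z ∈ ext M G ↔ ∃ τ ∈ M, z = val G τ := by
  unfold ext
  rw [ZFSet.mem_range]
  constructor
  · rintro ⟨y, rfl⟩; exact ⟨y.1, y.2, rfl⟩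
  · rintro ⟨τ, h, rfl⟩; exact ⟨⟨τ, h⟩, rfl⟩

theorem val_mem_ext {M : ZFSet.{u}} {G : Set ZFSet.{u}} {τ : ZFSet.{u}} (h : τ ∈ M) : val G τ ∈ ext M G := mem_ext.2 ⟨τ, h, rfl⟩

theorem snoc_val {G : Set ZFSet.{u}} {n : ℕ} (v : Fin n → ZFSet.{u}) (τ : ZFSet.{u}) :
    (Fin.snoc (fun j => val G (v j)) (val G τ) : Fin (n+1) → ZFSet.{u}) = fun j => val G ((Fin.snoc v τ : Fin (n+1) → ZFSet.{u}) j) := by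
  funext j
  refine Fin.lastCases ?_ (fun j => ?_) j <;> simp

theorem snoc_mem {M : ZFSet.{u}} {n : ℕ} {v : Fin n → ZFSet.{u}} {τ : ZFSet.{u}} (hv : ∀ j, v j ∈ M) (hτ : τ ∈ M) :
    ∀ j, (Fin.snoc v τ : Fin (n+1) → ZFSet.{u}) j ∈ M := by
  intro j
  refine Fin.lastCases ?_ (fun j => ?_) j <;> simp [hv, hτ]

theorem truth {i : I} {G : Set ZFSet.{u}} (hG : Gen (M i) G) {n : ℕ} (φ : BF n) (v : Fin n → ZFSet.{u}) (hv : ∀ j, v j ∈ M i) :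
    Sat (ext (M i) G) φ (fun j => val G (v j)) ↔ ∃ p ∈ G, Forces (M i) φ p v := by
  have g := hM.good i
  have hvN : ∀ j, val G (v j) ∈ ext (M i) G := fun j => val_mem_ext (hv j)
  induction φ with
  | falsum =>
    refine ⟨fun ⟨_, h⟩ => h.elim, ?_⟩
    rintro ⟨p, hp, h⟩; exact h.elim
  | equal s t => 
    rw [tix_spec s, tix_spec t]
    refine Iff.trans ⟨fun ⟨_, h⟩ => ?_, fun h => ⟨hvN, ?_⟩⟩ (eqF_truth hG (hv (tix s)) (hv (tix t)))
    · exact Subtype.ext h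
    · exact congrArg Subtype.val h
  | rel R ts => 
    cases R
    have e : ts = fun j => Term.var (Sum.inr (tix (ts j))) := funext fun j => tix_spec _
    rw [e]
    refine Iff.trans ⟨fun ⟨_, h⟩ => ?_, fun h => ⟨hvN, ?_⟩⟩ (memF_truth hG (hv (tix (ts 0))) (hv (tix (ts 1))))
    · exact h
    · exact h
  | imp φ ψ h1 h2 => 
    have e : Sat (ext (M i) G) (φ.imp ψ) (fun j => val G (v j)) ↔ (Sat (ext (M i) G) φ (fun j => val G (v j)) → Sat (ext (M i) G) ψ (fun j => val G (v j))) := by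
      constructor
      · rintro ⟨_, h⟩ ⟨_, h'⟩; exact ⟨hvN, h h'⟩
      · intro h; exact ⟨hvN, fun h' => (h ⟨hvN, h'⟩).2⟩
    have a1 := h1 v hv hvN
    have a2 := h2 v hv hvN
    refine e.trans ((imp_congr a1 a2).trans ?_)
    constructor
    · intro h
      obtain ⟨p, hp, -, hd⟩ := hG.below (n := _) (fun (i : I) v r => Forces (M i) (φ.imp ψ) r (fun j => v j) ∨ (Forces (M i) φ r (fun j => v j) ∧ ∀ s, s ∈ M i → le (M i) s r → ¬ Forces (M i) ψ s (fun j => v j)))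
         v hv hG.one (by
           intro q hq
           by_cases hh : Forces (M i) (φ.imp ψ) q v
           · exact ⟨q, le_refl' g (le_dom g hq), Or.inl hh⟩
           · unfold Forces at hh
             push Not at hh
             obtain ⟨r, hr, hrq, h3, h4⟩ := hh
             exact ⟨r, hrq, Or.inr ⟨h3, h4⟩⟩)
      rcases hd with hd | ⟨h3, h4⟩
      · exact ⟨p, hp, hd⟩
      · obtain ⟨q, hq, h5⟩ := h ⟨p, hp, h3⟩
        obtain ⟨r, hr, hr1, hr2⟩ := hG.dir p hp q hq
        exact absurd (h5.mono g hr2) (h4 r (le_memM g hr1) hr1)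
    · rintro ⟨p, hp, h⟩ ⟨q, hq, h'⟩
      obtain ⟨r, hr, hr1, hr2⟩ := hG.dir p hp q hq
      obtain ⟨s, hs, -, h3⟩ := hG.below (n := _) (fun (i : I) v r => Forces (M i) ψ r (fun j => v j)) v hv hr (by
        intro t ht
        unfold Forces at h
        obtain ⟨s, hs, h1, h2⟩ := h t (le_memM g ht) (le_trans' g ht hr1) (h'.mono g (le_trans' g ht hr2))
        exact ⟨s, h1, h2⟩)
      exact ⟨s, hs, h3⟩
  | @all n φ ih =>
    have e : Sat (ext (M i) G) φ.all (fun j => val G (v j)) ↔ ∀ τ ∈ M i, Sat (ext (M i) G) φ (fun j => val G ((Fin.snoc v τ : Fin (n+1) → ZFSet.{u}) j)) := by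
      constructor
      · rintro ⟨_, h⟩ τ hτ
        have h2 := h ⟨val G τ, val_mem_ext hτ⟩
        rw [← Sat_coe, snoc_coe] at h2
        rwa [← snoc_val]
      · intro h; refine ⟨hvN, ?_⟩
        rintro ⟨z, hz⟩
        obtain ⟨τ, hτ, rfl⟩ := mem_ext.1 hz
        have h2 := h τ hτ
        rw [← snoc_val] at h2
        rw [← Sat_coe, snoc_coe]
        exact h2
    rw [e]
    have e2 : (∀ τ ∈ M i, Sat (ext (M i) G) φ (fun j => val G ((Fin.snoc v τ : Fin (n+1) → ZFSet.{u}) j))) ↔ ∀ τ ∈ M i, ∃ p ∈ G, Forces (M i) φ p (Fin.snoc v τ) := 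
      forall₂_congr fun τ hτ => ih _ (snoc_mem hv hτ) (fun j => val_mem_ext (snoc_mem hv hτ j))
    rw [e2]
    clear e e2 ih
    constructor
    · intro h
      have inst : Dfn M (n := n+1+1+1) (fun i w => Forces (M i) φ (w (Fin.last _)) (Fin.snoc (fun j => w j.castSucc.castSucc.castSucc) (w (Fin.last (n+1)).castSucc))) := 
        @Dfn.forces _ M _ _ φ _ (fun i w => w (Fin.last _)) (fun j i w => (Fin.snoc (fun j => w j.castSucc.castSucc.castSucc) (w (Fin.last (n+1)).castSucc) : Fin (n+1) → ZFSet.{u}) j) _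
         (DFun.snocs (fun j i w => w j.castSucc.castSucc.castSucc) (fun i w => w (Fin.last (n+1)).castSucc))
      obtain ⟨p, hp, -, hd⟩ := hG.below (n := _) (fun (i : I) v r => Forces (M i) φ.all r (fun j => v j) ∨ (∃ τ, τ ∈ M i ∧ ∀ s, s ∈ M i → le (M i) s r → ¬ Forces (M i) φ s (Fin.snoc (fun j => v j) τ)))
         v hv hG.one (by
           intro q hq
           by_cases hh : Forces (M i) φ.all q v
           · exact ⟨q, le_refl' g (le_dom g hq), Or.inl hh⟩
           · unfold Forces at hh
             push Not at hh
             obtain ⟨τ, hτ, r, hr, hrq, h3⟩ := hh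
             exact ⟨r, hrq, Or.inr ⟨τ, hτ, h3⟩⟩)
      rcases hd with hd | ⟨τ, hτ, h4⟩
      · exact ⟨p, hp, hd⟩
      · obtain ⟨q, hq, h5⟩ := h τ hτ
        obtain ⟨r, hr, hr1, hr2⟩ := hG.dir p hp q hq
        exact absurd (h5.mono g hr2) (h4 r (le_memM g hr1) hr1)
    · rintro ⟨p, hp, h⟩ τ hτ
      obtain ⟨s, hs, -, h3⟩ := hG.below (n := _) (fun (i : I) v r => Forces (M i) φ r (fun j => v j)) (Fin.snoc v τ) (snoc_mem hv hτ) hp (by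
        intro t ht
        unfold Forces at h
        obtain ⟨s, hs, h1, h2⟩ := h τ hτ t (le_memM g ht) ht
        exact ⟨s, h1, h2⟩)
      exact ⟨s, hs, h3⟩

end

end CtmForcing

namespace CtmForcing
open FirstOrder FirstOrder.Language
attribute [local instance] zfStruct
universe u w
set_option linter.all false
set_option synthInstance.maxSize 100000
set_option synthInstance.maxHeartbeats 400000

instance DFun.snoc1 {I : Type w} {M : I → ZFSet.{u}} {n k : ℕ} (t : Fin k → I → (Fin n → ZFSet.{u}) → ZFSet.{u})
    [ht : ∀ j, DFun M (t j)] (s : I → (Fin n → ZFSet.{u}) → ZFSet.{u}) [hs : DFun M s] (j : Fin (k+1)) :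
    DFun M (fun i v => (Fin.snoc (fun j => t j i v) (s i v) : Fin (k+1) → ZFSet.{u}) j) := DFun.snocs t s j

section
variable {I : Type w} {M : I → ZFSet.{u}} [hM : VF M] {i : I} {G : Set ZFSet.{u}} (hG : Gen (M i) G)

omit hM in
theorem ext_tr (g : Good (M i)) : (ext (M i) G).IsTransitive := by
  intro y hy z hz
  obtain ⟨τ, hτ, rfl⟩ := mem_ext.1 hy
  obtain ⟨σ, p, hp, h, rfl⟩ := mem_val.1 hz
  exact val_mem_ext (mem_of_pair (g := ∅) g (g.tr _ hτ h)).1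

include hG in
theorem sub_ext : M i ⊆ ext (M i) G := fun x hx => mem_ext.2 ⟨chk x, VF.chk_mem hx, (val_chk hG.one x).symm⟩

theorem mem_val_prod {G : Set ZFSet.{u}} (h1 : one ∈ G) {D z : ZFSet.{u}} : z ∈ val G (ZFSet.prod D {one}) ↔ ∃ x ∈ D, z = val G x := by
  rw [mem_val]
  constructor
  · rintro ⟨σ, p, hp, h, rfl⟩
    exact ⟨σ, (ZFSet.pair_mem_prod.1 h).1, rfl⟩
  · rintro ⟨x, hx, rfl⟩
    exact ⟨x, one, h1, ZFSet.pair_mem_prod.2 ⟨hx, by simp⟩, rfl⟩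

theorem prod_one_mem {D : ZFSet.{u}} (hD : D ∈ M i) : ZFSet.prod D {one} ∈ M i :=
  (inferInstance : DFun M (n := 1) (fun i v => ZFSet.prod (v 0) {one})).mem i ![D] (vec1 hD)

include hG in
theorem sat_sep {n : ℕ} (φ : BF (n+1)) (π : Fin n → ZFSet.{u}) (hπ : ∀ j, π j ∈ M i) {σ : ZFSet.{u}} (hσ : σ ∈ M i) :
    ZFSet.sep (fun z => Sat (ext (M i) G) φ (Fin.snoc (fun j => val G (π j)) z : Fin (n+1) → ZFSet.{u})) (val G σ) ∈ ext (M i) G := by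
  have g := hM.good i
  have d : DFun M (n := n+1) (fun i v => ZFSet.sep (fun z => ∃ x, x ∈ M i ∧ ∃ p, p ∈ M i ∧ z = ZFSet.pair x p ∧ 
    (∃ s, s ∈ M i ∧ ZFSet.pair x s ∈ v (Fin.last n) ∧ le (M i) p s) ∧ Forces (M i) φ p (Fin.snoc (fun j => v j.castSucc) x)) (ZFSet.prod (ZFSet.sUnion (ZFSet.sUnion (v (Fin.last n)))) (Po (M i)))) := inferInstance
  have dm := d.mem i (Fin.snoc π σ) (snoc_mem hπ hσ)
  simp only [Fin.snoc_last, Fin.snoc_castSucc] at dm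
  refine mem_ext.2 ⟨_, dm, ?_⟩
  ext z
  rw [ZFSet.mem_sep, mem_val (τ := ZFSet.sep _ _)]
  constructor
  · rintro ⟨hz, hS⟩
    obtain ⟨x, s, hs, hxs, rfl⟩ := mem_val.1 hz
    obtain ⟨hx, hsM⟩ := mem_of_pair (g := ∅) g (g.tr _ hσ hxs)
    rw [snoc_val, truth hG _ _ (snoc_mem hπ hx)] at hS
    obtain ⟨p, hp, hf⟩ := hS
    obtain ⟨q, hq, h1, h2⟩ := hG.dir p hp s hs
    refine ⟨x, q, hq, ZFSet.mem_sep.2 ⟨ZFSet.pair_mem_prod.2 ⟨mem_ssU hxs, hG.sub q hq⟩, x, hx, q, Po_mem g (hG.sub q hq), rfl, ⟨s, hsM, hxs, h2⟩, hf.mono g h1⟩, rfl⟩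
  · rintro ⟨x, p, hp, h, rfl⟩
    obtain ⟨-, x', hx, p', hpM, e, ⟨s, hs, hxs, hps⟩, hf⟩ := ZFSet.mem_sep.1 h
    obtain ⟨rfl, rfl⟩ := ZFSet.pair_injective e
    refine ⟨mem_val.2 ⟨x, s, hG.up p hp s hps, hxs, rfl⟩, ?_⟩
    rw [snoc_val, truth hG _ _ (snoc_mem hπ hx)]
    exact ⟨p, hp, hf⟩

theorem ext_lift {M : ZFSet.{u}} {G : Set ZFSet.{u}} {n : ℕ} (xs : Fin n → ZFSet.{u}) (h : ∀ j, xs j ∈ ext M G) :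
    ∃ π : Fin n → ZFSet.{u}, (∀ j, π j ∈ M) ∧ xs = fun j => val G (π j) := by
  choose π h1 h2 using fun j => mem_ext.1 (h j)
  exact ⟨π, h1, funext h2⟩

include hG in
theorem ext_sep (Q : ZFSet.{u} → Prop) (hQ : D1 (ext (M i) G) Q)
    (A : ZFSet.{u}) (hA : A ∈ ext (M i) G) : ZFSet.sep Q A ∈ ext (M i) G := by
  refine sepAx_sem (ext_tr (hM.good i)) (fun n φ => ?_) Q hQ A hA
  rw [rz_sepAx]
  rintro xs ⟨A, hA⟩
  obtain ⟨σ, hσ, rfl⟩ := mem_ext.1 hA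
  obtain ⟨π, hπ, e⟩ := ext_lift (fun j => (xs j : ZFSet.{u})) (fun j => (xs j).2)
  refine ⟨⟨_, sat_sep hG φ π hπ hσ⟩, fun x => ?_⟩
  rw [ZFSet.mem_sep, ← e, ← snoc_coe, Sat_coe]

include hG in
theorem ext_sub_of (Q : ZFSet.{u} → Prop) (hQ : D1 (ext (M i) G) Q) {D : ZFSet.{u}} (hD : D ∈ M i) {y : ZFSet.{u}}
    (h : ∀ z, z ∈ y ↔ (∃ x ∈ D, z = val G x) ∧ Q z) : y ∈ ext (M i) G := by
  have := ext_sep hG Q hQ _ (val_mem_ext (G := G) (prod_one_mem hD))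
  convert this using 1
  ext z; rw [h, ZFSet.mem_sep, mem_val_prod hG.one]

include hG in
theorem ext_good : Good (ext (M i) G) := by
  have g := hM.good i
  have trN : Tr (fun _ : Unit => ext (M i) G) := ⟨fun _ => ext_tr g⟩
  refine ⟨ext_tr g, ?_, ?_, ?_, ?_, ext_sep hG⟩
  · intro a ha b hb
    obtain ⟨σ, hσ, rfl⟩ := mem_ext.1 ha
    obtain ⟨τ, hτ, rfl⟩ := mem_ext.1 hb
    refine mem_ext.2 ⟨ZFSet.prod {σ, τ} {one}, prod_one_mem (g.pair _ hσ _ hτ), ?_⟩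
    ext z; rw [mem_val_prod hG.one]; simp
  · intro a ha
    obtain ⟨τ, hτ, rfl⟩ := mem_ext.1 ha
    have c : Cst (fun _ : Unit => ext (M i) G) (fun _ => val G τ) := ⟨fun _ => ha⟩
    refine ext_sub_of hG (fun z => ∃ y, y ∈ val G τ ∧ z ∈ y) inferInstance (VF.vf_mem hτ) (fun z => ?_)
    rw [ZFSet.mem_sUnion]
    refine ⟨fun h => ⟨?_, h⟩, fun h => h.2⟩
    obtain ⟨y, hy, hz⟩ := h
    obtain ⟨σ, p, hp, h, rfl⟩ := mem_val.1 hy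
    obtain ⟨ρ, q, hq, h', rfl⟩ := mem_val.1 hz
    have hσ := (mem_of_pair (g := ∅) g (g.tr _ hτ h)).1
    exact ⟨ρ, mem_vf.2 ⟨(mem_of_pair (g := ∅) g (g.tr _ hσ h')).1, (rank_lt_of_pair_mem h').trans (rank_lt_of_pair_mem h)⟩, rfl⟩
  · intro a ha
    obtain ⟨τ, hτ, rfl⟩ := mem_ext.1 ha
    have c : Cst (fun _ : Unit => ext (M i) G) (fun _ => val G τ) := ⟨fun _ => ha⟩
    have d : DFun M (n := 1) (fun i v => powM (M i) (ZFSet.prod (ZFSet.sUnion (ZFSet.sUnion (v 0))) (Po (M i)))) := inferInstance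
    have dm := d.mem i ![τ] (vec1 hτ)
    refine ext_sub_of hG (fun z => z ⊆ val G τ) inferInstance dm (fun z => ?_)
    rw [mem_powM]
    constructor
    · rintro ⟨hz, hsub⟩
      refine ⟨?_, hsub⟩
      obtain ⟨σ, hσ, rfl⟩ := mem_ext.1 hz
      have d2 : DFun M (n := 2) (fun i v => ZFSet.sep (fun z => ∃ x, x ∈ M i ∧ ∃ p, p ∈ M i ∧ z = ZFSet.pair x p ∧ MemF (M i) p x (v 1)) (ZFSet.prod (ZFSet.sUnion (ZFSet.sUnion (v 0))) (Po (M i)))) := inferInstance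
      have dm2 := d2.mem i ![τ, σ] (vec2 hτ hσ)
      refine ⟨_, mem_powM.2 ⟨dm2, fun z hz => (ZFSet.mem_sep.1 hz).1⟩, ?_⟩
      ext z
      rw [mem_val (τ := ZFSet.sep _ _)]
      constructor
      · intro hz
        obtain ⟨x, s, hs, hxs, rfl⟩ := mem_val.1 (hsub hz)
        obtain ⟨hx, hsM⟩ := mem_of_pair (g := ∅) g (g.tr _ hτ hxs)
        obtain ⟨p, hp, h⟩ := (memF_truth hG hx hσ).1 hz
        exact ⟨x, p, hp, ZFSet.mem_sep.2 ⟨ZFSet.pair_mem_prod.2 ⟨mem_ssU hxs, hG.sub p hp⟩, x, hx, p, Po_mem g (hG.sub p hp), rfl, h⟩, rfl⟩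
      · rintro ⟨x, p, hp, h, rfl⟩
        obtain ⟨-, x', hx, p', hpM, e, hf⟩ := ZFSet.mem_sep.1 h
        obtain ⟨rfl, rfl⟩ := ZFSet.pair_injective e
        exact (memF_truth hG hx hσ).2 ⟨p, hp, hf⟩
    · rintro ⟨⟨σ, hσ, rfl⟩, h⟩
      exact ⟨val_mem_ext (mem_powM.1 hσ).1, h⟩
  · obtain ⟨A, hA, h⟩ := g.inf
    exact ⟨A, sub_ext hG hA, h⟩

end

end CtmForcing

namespace CtmForcing
open FirstOrder FirstOrder.Language
attribute [local instance] zfStruct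
universe u w
set_option linter.all false
set_option synthInstance.maxSize 100000
set_option synthInstance.maxHeartbeats 400000

/-- least-rank witnesses -/
def MinW (M : ZFSet.{u}) (Q : ZFSet.{u} → Prop) (C : ZFSet.{u}) : Prop :=
  (∃ τ, τ ∈ M ∧ Q τ) ∧ ∀ τ, τ ∈ M → (τ ∈ C ↔ (Q τ ∧ ∀ τ', τ' ∈ M → Q τ' → τ ⊆ vf M τ'))

def RF {n : ℕ} (M : ZFSet.{u}) (φ : BF (n+2)) (v : Fin (n+2) → ZFSet.{u}) : Prop :=
  ∃ x, x ∈ M ∧ ∃ p, p ∈ M ∧ v (Fin.last n).castSucc = ZFSet.pair x p ∧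
    MinW M (fun τ => Forces M φ p (Fin.snoc (Fin.snoc (fun j => v j.castSucc.castSucc) x : Fin (n+1) → ZFSet.{u}) τ)) (v (Fin.last (n+1)))

section
variable {I : Type w} {M : I → ZFSet.{u}} [hM : VF M]

theorem Dfn.rF {n : ℕ} (φ : BF (n+2)) : Dfn M (fun i v => RF (M i) φ v) := by
  unfold RF MinW; infer_instance

theorem exists_F : ∃ F : (Σ n : ℕ, BF (n + 2)) → (Σ n : ℕ, BF (n + 2)), ∀ (φ : Σ n : ℕ, BF (n + 2)) (i : I) (G : Set ZFSet.{u}),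
    Gen (M i) G → Sentence.Realize {x // x ∈ M i} (replAx (F φ).2) → Sentence.Realize {x // x ∈ ext (M i) G} (replAx φ.2) := by
  choose F hF using fun φ : Σ n : ℕ, BF (n + 2) => repl_sem (Dfn.rF (M := M) φ.2)
  refine ⟨F, fun φ i G hG hR => ?_⟩
  have hF := hF φ i hR
  clear hR
  have g := hM.good i
  obtain ⟨n, φ⟩ := φ
  apply replAx_of_sem
  intro xs hxs A hA hfun
  dsimp only at *
  obtain ⟨π, hπ, rfl⟩ := ext_lift xs hxs
  obtain ⟨σ, hσ, rfl⟩ := mem_ext.1 hA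
  have d : DFun M (n := 1) (fun i v => ZFSet.prod (ZFSet.sUnion (ZFSet.sUnion (v 0))) (Po (M i))) := inferInstance
  obtain ⟨B, hB, hB'⟩ := hF π hπ _ (d.mem i ![σ] (vec1 hσ)) (by
    intro z C C' hz hC hC' hzA h1 h2
    unfold RF at h1 h2
    simp only [Fin.snoc_last, Fin.snoc_castSucc] at h1 h2
    obtain ⟨x, hx, p, hp, rfl, h1⟩ := h1
    obtain ⟨x', hx', p', hp', e, h2⟩ := h2
    obtain ⟨rfl, rfl⟩ := ZFSet.pair_injective e
    ext τ
    exact ⟨fun h => (h2.2 τ (g.tr _ hC h)).2 ((h1.2 τ (g.tr _ hC h)).1 h), fun h => (h1.2 τ (g.tr _ hC' h)).2 ((h2.2 τ (g.tr _ hC' h)).1 h)⟩)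
  have trN : Tr (fun _ : Unit => ext (M i) G) := ⟨fun _ => ext_tr g⟩
  have cA : Cst (fun _ : Unit => ext (M i) G) (fun _ => val G σ) := ⟨fun _ => hA⟩
  have cπ : ∀ j, Cst (fun _ : Unit => ext (M i) G) (fun _ => val G (π j)) := fun j => ⟨fun _ => hxs j⟩
  have hD : D1 (ext (M i) G) (fun y => ∃ x, x ∈ ext (M i) G ∧ x ∈ val G σ ∧ Sat (ext (M i) G) φ (Fin.snoc (Fin.snoc (fun j => val G (π j)) x : Fin (n+1) → ZFSet.{u}) y)) := by
    infer_instance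
  have hW := ext_sep hG _ hD _ (val_mem_ext (G := G) (prod_one_mem (g.union _ hB)))
  refine ⟨_, hW, fun y hy => ?_⟩
  rw [ZFSet.mem_sep]
  refine ⟨fun h => h.2, fun h => ⟨?_, h⟩⟩
  rw [mem_val_prod hG.one]
  obtain ⟨x, hx, hxA, hS⟩ := h
  obtain ⟨ξ, s, hs, hξs, rfl⟩ := mem_val.1 hxA
  obtain ⟨τ0, hτ0, rfl⟩ := mem_ext.1 hy
  obtain ⟨hξ, hsM⟩ := mem_of_pair (g := ∅) g (g.tr _ hσ hξs)
  have hS' := hS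
  rw [snoc_val, snoc_val, truth hG _ _ (snoc_mem (snoc_mem hπ hξ) hτ0)] at hS'
  obtain ⟨p, hp, hf⟩ := hS'
  have hpM := Po_mem g (hG.sub p hp)
  -- a witness of least rank
  obtain ⟨τ1, ⟨hτ1, hf1⟩, hmin⟩ := WellFounded.has_min (InvImage.wf ZFSet.rank (wellFounded_lt (α := Ordinal.{u}))) 
    {τ | τ ∈ M i ∧ Forces (M i) φ p (Fin.snoc (Fin.snoc π ξ : Fin (n+1) → ZFSet.{u}) τ)} ⟨τ0, hτ0, hf⟩
  have hmin' : ∀ τ', τ' ∈ M i → Forces (M i) φ p (Fin.snoc (Fin.snoc π ξ : Fin (n+1) → ZFSet.{u}) τ') → τ1.rank ≤ τ'.rank := 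
    fun τ' h1 h2 => not_lt.1 (hmin τ' ⟨h1, h2⟩)
  have dC : DFun M (n := n+3) (fun i v => ZFSet.sep (fun τ => Forces (M i) φ (v (Fin.last (n+2))) (Fin.snoc (Fin.snoc (fun j => v j.castSucc.castSucc.castSucc) (v (Fin.last (n)).castSucc.castSucc) : Fin (n+1) → ZFSet.{u}) τ)) 
    (powM (M i) (vf (M i) (v (Fin.last (n+1)).castSucc)))) := inferInstance
  have hC := dC.mem i (Fin.snoc (Fin.snoc (Fin.snoc π ξ : Fin (n+1) → ZFSet.{u}) τ1 : Fin (n+2) → ZFSet.{u}) p) (snoc_mem (snoc_mem (snoc_mem hπ hξ) hτ1) hpM)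
  simp only [Fin.snoc_last, Fin.snoc_castSucc] at hC
  set C := ZFSet.sep _ _ with hCd
  have mC : ∀ τ, τ ∈ C ↔ (τ ∈ M i ∧ τ.rank ≤ τ1.rank) ∧ Forces (M i) φ p (Fin.snoc (Fin.snoc π ξ : Fin (n+1) → ZFSet.{u}) τ) := by
    intro τ
    rw [hCd, ZFSet.mem_sep, mem_powM]
    refine and_congr_left fun _ => and_congr_right fun h => sub_vf_iff g.tr h
  have hCB : C ∈ B := (hB' C hC).2 ⟨ZFSet.pair ξ p, g.opair hξ hpM, ZFSet.pair_mem_prod.2 ⟨mem_ssU hξs, hG.sub p hp⟩, by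
    unfold RF
    simp only [Fin.snoc_last, Fin.snoc_castSucc]
    refine ⟨ξ, hξ, p, hpM, rfl, ⟨τ0, hτ0, hf⟩, fun τ hτ => ?_⟩
    rw [mC]
    constructor
    · rintro ⟨⟨_, hr⟩, h⟩
      exact ⟨h, fun τ' hτ' h' => (sub_vf_iff g.tr hτ).2 (hr.trans (hmin' τ' hτ' h'))⟩
    · rintro ⟨h, h'⟩
      exact ⟨⟨hτ, (sub_vf_iff g.tr hτ).1 (h' τ1 hτ1 hf1)⟩, h⟩⟩
  refine ⟨τ1, ZFSet.mem_sUnion.2 ⟨C, hCB, (mC τ1).2 ⟨⟨hτ1, le_rfl⟩, hf1⟩⟩, ?_⟩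
  refine hfun (val G ξ) _ _ hx hy (val_mem_ext hτ1) hxA hS ?_
  rw [snoc_val, snoc_val, truth hG _ _ (snoc_mem (snoc_mem hπ hξ) hτ1)]
  exact ⟨p, hp, hf1⟩

variable {i : I} {G : Set ZFSet.{u}} (hG : Gen (M i) G)

include hG in
theorem ext_ord (α : ZFSet.{u}) (hα : IsOrd α) : α ∈ M i ↔ α ∈ ext (M i) G := by
  have g := hM.good i
  refine ⟨fun h => sub_ext hG h, fun h => ?_⟩
  obtain ⟨τ, hτ, rfl⟩ := mem_ext.1 h
  have hr := rank_val (G := G) τ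
  set α := val G τ
  have key : ∀ x : ZFSet.{u}, IsOrd x ↔ x.IsOrdinal := fun x => by
    rw [ZFSet.isOrdinal_iff_forall_mem_isTransitive]; rfl
  have d : DFun M (n := 1) (fun i v => ZFSet.sep (fun z => (∀ y, y ∈ z → y ⊆ z) ∧ ∀ x, x ∈ z → ∀ y, y ∈ x → y ⊆ x) (vf (M i) (v 0))) := inferInstance
  have dm := d.mem i ![τ] (vec1 hτ)
  set o := ZFSet.sep _ _ with ho
  have mo : ∀ z, z ∈ o ↔ (z ∈ M i ∧ z.rank < τ.rank) ∧ IsOrd z := by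
    intro z
    rw [ho, ZFSet.mem_sep, mem_vf]
    rfl
  have oo : o.IsOrdinal := by
    rw [← key]
    refine ⟨fun y hy z hz => ?_, fun y hy => ((mo y).1 hy).2.1⟩
    have h1 := (mo y).1 hy
    refine (mo z).2 ⟨⟨g.tr _ h1.1.1 hz, (ZFSet.rank_lt_of_mem hz).trans h1.1.2⟩, ?_⟩
    rw [key] at h1 ⊢
    exact h1.2.mem hz
  rcases ZFSet.IsOrdinal.mem_trichotomous ((key α).1 hα) oo with h | h | h
  · exact g.tr _ dm h
  · rw [h]; exact dm
  · exfalso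
    have := (mo o).2 ⟨⟨dm, (ZFSet.rank_lt_of_mem h).trans_le hr⟩, (key o).2 oo⟩
    exact ZFSet.mem_irrefl _ this

include hG in
theorem ext_ne : M i ≠ ext (M i) G := by
  have g := hM.good i
  intro e
  have d : DFun M (n := 0) (fun i v => ZFSet.sep (fun z => ∃ p, p ∈ M i ∧ z = ZFSet.pair (chk p) p) (ZFSet.prod (vf (M i) {chk (Po (M i))}) (Po (M i)))) := inferInstance
  have dm := d.mem i Fin.elim0 (fun j => j.elim0)
  have hv := val_mem_ext (G := G) dm
  rw [← e] at hv
  have mv : ∀ z, z ∈ val G (ZFSet.sep (fun z => ∃ p, p ∈ M i ∧ z = ZFSet.pair (chk p) p) (ZFSet.prod (vf (M i) {chk (Po (M i))}) (Po (M i)))) ↔ z ∈ G := by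
    intro z
    rw [mem_val]
    constructor
    · rintro ⟨σ, p, hp, h, rfl⟩
      obtain ⟨-, p', hp', e⟩ := ZFSet.mem_sep.1 h
      obtain ⟨rfl, rfl⟩ := ZFSet.pair_injective e
      rwa [val_chk hG.one]
    · intro hz
      have hzP := hG.sub z hz
      have hzM := Po_mem g hzP
      refine ⟨chk z, z, hz, ZFSet.mem_sep.2 ⟨ZFSet.pair_mem_prod.2 ⟨mem_vf.2 ⟨VF.chk_mem hzM, ?_⟩, hzP⟩, z, hzM, rfl⟩, (val_chk hG.one z).symm⟩
      exact (rank_lt_of_pair_mem (mem_chk.2 ⟨z, hzP, rfl⟩)).trans (ZFSet.rank_lt_of_mem (by simp))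
  set Γ := val G _ with hΓ
  have d2 : DFun M (n := 1) (fun i v => ZFSet.sep (fun z => z ∉ v 0) (Po (M i))) := inferInstance
  have dm2 := d2.mem i ![Γ] (vec1 hv)
  obtain ⟨q, hq, hq'⟩ := hG.meet _ dm2 (by
    intro p hp
    obtain ⟨q, r, h1, h2, h3⟩ := (isPo g).split p hp
    by_cases hqG : q ∈ G
    · by_cases hrG : r ∈ G
      · obtain ⟨s, -, hs⟩ := hG.dir q hqG r hrG
        exact absurd hs (h3 s)
      · exact ⟨r, ZFSet.mem_sep.2 ⟨le_dom g h2, fun h => hrG ((mv _).1 h)⟩, h2⟩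
    · exact ⟨q, ZFSet.mem_sep.2 ⟨le_dom g h1, fun h => hqG ((mv _).1 h)⟩, h1⟩)
  exact (ZFSet.mem_sep.1 hq').2 ((mv q).2 hq)

theorem ext_countable {M : ZFSet.{u}} (hc : M.toSet.Countable) (G : Set ZFSet.{u}) : (ext M G).toSet.Countable := by
  have : (ext M G).toSet = val G '' M.toSet := by
    ext z
    constructor
    · intro h
      obtain ⟨τ, hτ, rfl⟩ := mem_ext.1 h
      exact ⟨τ, hτ, rfl⟩
    · rintro ⟨τ, hτ, rfl⟩; exact val_mem_ext hτ
  rw [this]; exact hc.image _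

end

end CtmForcing

namespace CtmForcing
open FirstOrder FirstOrder.Language
attribute [local instance] zfStruct
universe u w
set_option linter.all false
set_option synthInstance.maxSize 100000
set_option synthInstance.maxHeartbeats 400000

/-- name of an ordered pair -/
noncomputable def opn (a b : ZFSet.{u}) : ZFSet.{u} :=
  ZFSet.prod {ZFSet.prod {a} {one}, ZFSet.prod {a, b} {one}} {one}

theorem val_opn {G : Set ZFSet.{u}} (h1 : one ∈ G) (a b : ZFSet.{u}) : val G (opn a b) = ZFSet.pair (val G a) (val G b) := by
  have e1 : val G (ZFSet.prod {a} {one}) = {val G a} := by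
    ext z; rw [mem_val_prod h1]; simp
  have e2 : val G (ZFSet.prod {a, b} {one}) = {val G a, val G b} := by
    ext z; rw [mem_val_prod h1]; simp
  unfold opn ZFSet.pair
  ext z; rw [mem_val_prod h1, ← e1, ← e2]; simp

section
variable {I : Type w} {M : I → ZFSet.{u}} [hM : VF M]
instance DFun.opn {n : ℕ} {s t : I → (Fin n → ZFSet.{u}) → ZFSet.{u}} [hs : DFun M s] [ht : DFun M t] :
   DFun M (fun i v => opn (s i v) (t i v)) := by
  unfold CtmForcing.opn; infer_instance

theorem ext_ac {i : I} {G : Set ZFSet.{u}} (hG : Gen (M i) G) 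
    (h : ∀ a ∈ M i, ∃ o ∈ M i, ∃ f ∈ M i, IsOrd o ∧ IsSurj o a f) :
    ∀ a ∈ ext (M i) G, ∃ o ∈ ext (M i) G, ∃ f ∈ ext (M i) G, IsOrd o ∧ IsSurj o a f := by
  have g := hM.good i
  have gN := ext_good hG
  intro a ha
  by_cases hne : ∃ z, z ∈ a
  swap
  · have : a = ∅ := by
      ext z; simp; exact fun hz => hne ⟨z, hz⟩
    subst this
    refine ⟨∅, ha, ∅, ha, ⟨?_, ?_⟩, ?_, ?_, ?_, ?_⟩ 
    · intro y hy; simp at hy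
    all_goals simp
  obtain ⟨z0, hz0⟩ := hne
  obtain ⟨τ, hτ, rfl⟩ := mem_ext.1 ha
  have hz0N := gN.tr _ ha hz0
  obtain ⟨o, ho, f, hf, hord, hs1, hs2, hs3, hs4⟩ := h _ (g.union _ (g.union _ hτ))
  have hoN := sub_ext hG ho
  have d : DFun M (n := 3) (fun i v => ZFSet.sep (fun z => ∃ β, β ∈ M i ∧ ∃ x, x ∈ M i ∧ ZFSet.pair β x ∈ v 0 ∧ z = opn (chk β) x) 
    (powM (M i) (ZFSet.prod (powM (M i) (ZFSet.prod (vf (M i) (chk (v 1)) ∪ (ZFSet.sUnion (ZFSet.sUnion (v 2)))) {one})) {one}))) := inferInstance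
  have dm := d.mem i ![f, o, τ] (vec3 hf ho hτ)
  set E := ZFSet.sep _ _ with hE
  have mE : ∀ β x, ZFSet.pair β x ∈ f → opn (chk β) x ∈ E := by
    intro β x hβx
    obtain ⟨hβ, hx⟩ := mem_of_pair (g := ∅) g (g.tr _ hf hβx)
    obtain ⟨β', hβ', x', hx', e⟩ := hs1 _ hβx
    obtain ⟨rfl, rfl⟩ := ZFSet.pair_injective e
    have a1 : chk β ∈ vf (M i) (chk o) ∪ (ZFSet.sUnion (ZFSet.sUnion τ)) :=
      ZFSet.mem_union.2 (Or.inl (mem_vf.2 ⟨VF.chk_mem hβ, rank_lt_of_pair_mem (mem_chk.2 ⟨β, hβ', rfl⟩)⟩))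
    have a2 : x ∈ vf (M i) (chk o) ∪ (ZFSet.sUnion (ZFSet.sUnion τ)) := ZFSet.mem_union.2 (Or.inr hx')
    have b1 : ∀ D : ZFSet.{u}, D ∈ M i → D ⊆ vf (M i) (chk o) ∪ (ZFSet.sUnion (ZFSet.sUnion τ)) → 
       ZFSet.prod D {one} ∈ powM (M i) (ZFSet.prod (vf (M i) (chk o) ∪ (ZFSet.sUnion (ZFSet.sUnion τ))) {one}) := by
      intro D hD hsub
      refine mem_powM.2 ⟨prod_one_mem hD, fun z hz => ?_⟩
      obtain ⟨p, hp, q, hq, rfl⟩ := ZFSet.mem_prod.1 hz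
      exact ZFSet.pair_mem_prod.2 ⟨hsub hp, hq⟩
    have hcβ := VF.chk_mem (M := M) (i := i) hβ
    have s1 := g.singleton hcβ
    have s2 := g.pair _ hcβ _ hx
    refine ZFSet.mem_sep.2 ⟨mem_powM.2 ⟨prod_one_mem (g.pair _ (prod_one_mem s1) _ (prod_one_mem s2)), fun z hz => ?_⟩, β, hβ, x, hx, hβx, rfl⟩
    obtain ⟨p, hp, q, hq, rfl⟩ := ZFSet.mem_prod.1 hz
    refine ZFSet.pair_mem_prod.2 ⟨?_, hq⟩
    rcases ZFSet.mem_pair.1 hp with rfl | rfl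
    · refine b1 _ s1 fun z hz => ?_
      rw [ZFSet.mem_singleton] at hz; subst hz; exact a1
    · refine b1 _ s2 fun z hz => ?_
      rcases ZFSet.mem_pair.1 hz with rfl | rfl
      · exact a1
      · exact a2
  obtain ⟨H, hHN, mH⟩ : ∃ H ∈ ext (M i) G, ∀ β z, ZFSet.pair β z ∈ H ↔ ∃ x, ZFSet.pair β x ∈ f ∧ z = val G x := by
    refine ⟨_, val_mem_ext (G := G) (prod_one_mem dm), fun β z => ?_⟩
    rw [mem_val_prod hG.one]
    constructor
    · rintro ⟨y, hy, e⟩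
      obtain ⟨-, β', _, x, _, hfx, rfl⟩ := ZFSet.mem_sep.1 hy
      rw [val_opn hG.one, val_chk hG.one] at e
      obtain ⟨rfl, rfl⟩ := ZFSet.pair_injective e
      exact ⟨x, hfx, rfl⟩
    · rintro ⟨x, hfx, rfl⟩
      exact ⟨_, mE β x hfx, by rw [val_opn hG.one, val_chk hG.one]⟩
  have : Fact (Good (ext (M i) G)) := ⟨gN⟩
  have d2 : DFun (fun _ : Unit => ext (M i) G) (n := 4) (fun _ v => ZFSet.sep (fun w => ∃ β, β ∈ ext (M i) G ∧ ∃ z, z ∈ ext (M i) G ∧ w = ZFSet.pair β z ∧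
    (ZFSet.pair β z ∈ v 0 ∨ (z = v 1 ∧ ¬ ∃ z', z' ∈ v 3 ∧ ZFSet.pair β z' ∈ v 0))) (ZFSet.prod (v 2) (v 3))) := inferInstance
  have dm2 := d2.mem () ![H, z0, o, val G τ] (by intro j; fin_cases j <;> assumption)
  set K := ZFSet.sep _ _ with hK
  have mK : ∀ β z, ZFSet.pair β z ∈ K ↔ (β ∈ o ∧ z ∈ val G τ) ∧ (ZFSet.pair β z ∈ H ∨ (z = z0 ∧ ¬ ∃ z', z' ∈ val G τ ∧ ZFSet.pair β z' ∈ H)) := by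
    intro β z
    rw [hK, ZFSet.mem_sep, ZFSet.pair_mem_prod]
    refine and_congr_right fun hm => ?_
    constructor
    · rintro ⟨β', _, z', _, e, h⟩
      obtain ⟨rfl, rfl⟩ := ZFSet.pair_injective e
      exact h
    · intro h
      exact ⟨β, gN.tr _ hoN hm.1, z, gN.tr _ ha hm.2, rfl, h⟩
  refine ⟨o, hoN, K, dm2, hord, ?_, ?_, ?_, ?_⟩
  · intro w hw
    obtain ⟨x, hx, y, hy, rfl⟩ := ZFSet.mem_prod.1 (ZFSet.mem_sep.1 hw).1
    exact ⟨x, hx, y, hy, rfl⟩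
  · intro β hβ
    by_cases hh : ∃ z', z' ∈ val G τ ∧ ZFSet.pair β z' ∈ H
    · obtain ⟨z, hz, h⟩ := hh
      exact ⟨z, hz, (mK _ _).2 ⟨⟨hβ, hz⟩, Or.inl h⟩⟩
    · exact ⟨z0, hz0, (mK _ _).2 ⟨⟨hβ, hz0⟩, Or.inr ⟨rfl, hh⟩⟩⟩
  · intro β z z' h1 h2
    obtain ⟨h3, h4⟩ := (mK _ _).1 h1
    obtain ⟨h5, h6⟩ := (mK _ _).1 h2
    rcases h4 with h4 | ⟨rfl, h4⟩
    · rcases h6 with h6 | ⟨rfl, h6⟩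
      · obtain ⟨x, hx, rfl⟩ := (mH _ _).1 h4
        obtain ⟨x', hx', rfl⟩ := (mH _ _).1 h6
        rw [hs3 _ _ _ hx hx']
      · exact absurd ⟨z, h3.2, h4⟩ h6
    · rcases h6 with h6 | ⟨rfl, h6⟩
      · exact absurd ⟨z', h5.2, h6⟩ h4
      · rfl
  · intro z hz
    obtain ⟨x, p, hp, hxp, rfl⟩ := mem_val.1 hz
    obtain ⟨β, hβ, hβx⟩ := hs4 x (mem_ssU hxp)
    exact ⟨β, hβ, (mK _ _).2 ⟨⟨hβ, hz⟩, Or.inl ((mH _ _).2 ⟨x, hβx, rfl⟩)⟩⟩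

end

/-- the index type -/
def I1 (p q : Σ n, BF (n+2)) : Type (u+1) := {M : ZFSet.{u} // Good M ∧ Sentence.Realize {x // x ∈ M} (replAx p.2) ∧ Sentence.Realize {x // x ∈ M} (replAx q.2)}

/-- the family -/
def M1 (p q : Σ n, BF (n+2)) (i : I1.{u} p q) : ZFSet.{u} := i.1

/-- number of leading quantifiers -/
def qd : ∀ {n : ℕ}, BF n → ℕ
  | _, .all f => qd f + 1
  | _, _ => 0

theorem qd_alls : ∀ {n : ℕ} (φ : BF n), qd φ.alls = n + qd φ
  | 0, φ => by simp [BoundedFormula.alls]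
  | n+1, φ => by
    have := qd_alls (n := n) φ.all
    rw [BoundedFormula.alls, this, qd]; omega

theorem qd_replAx {n : ℕ} (φ : BF (n+2)) : qd (replAx φ) = n + 1 := by
  unfold replAx
  exact (qd_alls _).trans rfl

/-- replacement instances are infinitely many -/
theorem replScheme_inf : (replScheme).Infinite := by
  refine Set.infinite_of_injective_forall_mem (f := fun n : ℕ => (replAx (eqf (0 : Fin (n+2)) 0))) ?_ (fun n => ⟨⟨n, eqf 0 0⟩, rfl⟩)
  intro a b h
  have := congrArg (qd (n := 0)) h
  simp only [qd_replAx] at this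
  omega

theorem exists_seven (p q : Σ n, BF (n+2)) : ∃ Ω : Finset SetLang.Sentence, Ω.card = 7 ∧ (∀ s ∈ Ω, ∃ p : Σ n : ℕ, BF (n + 2), s = replAx p.2) ∧ replAx p.2 ∈ Ω ∧ replAx q.2 ∈ Ω := by
  classical
  obtain ⟨Ω, h1, h2, h3⟩ := replScheme_inf.exists_superset_ncard_eq (s := {replAx p.2, replAx q.2}) (k := 7) (by
    rintro s (rfl | rfl)
    · exact ⟨p, rfl⟩
    · exact ⟨q, rfl⟩) (by simp) ((Set.ncard_insert_le _ _).trans (by simp))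
  have hfin : Ω.Finite := Set.finite_of_ncard_ne_zero (by omega)
  refine ⟨hfin.toFinset, ?_, ?_, ?_, ?_⟩
  · exact (Set.ncard_eq_toFinset_card Ω hfin).symm.trans h3
  · intro s hs
    obtain ⟨p, hp⟩ := h2 ((hfin.mem_toFinset).1 hs)
    exact ⟨p, hp.symm⟩
  · exact hfin.mem_toFinset.2 (h1 (by simp))
  · exact hfin.mem_toFinset.2 (h1 (by simp))

theorem extensions_of_ctms_overhead :
    ∃ (Ω : Finset SetLang.Sentence)
      (F : (Σ n : ℕ, BF (n + 2)) → (Σ n : ℕ, BF (n + 2))),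
      Ω.card = 7 ∧
      (∀ s ∈ Ω, ∃ p : Σ n : ℕ, BF (n + 2), s = replAx p.2) ∧
      ∀ M : ZFSet, M.toSet.Countable → M.IsTransitive →
        ZModels M (Z ∪ ↑Ω) →
        ∀ Φ : Set (Σ n : ℕ, BF (n + 2)),
          ZModels M ((fun p => replAx (F p).2) '' Φ) →
          ∃ N : ZFSet, M ⊆ N ∧ M ≠ N ∧ N.toSet.Countable ∧ N.IsTransitive ∧
            (∀ α : ZFSet, IsOrd α → (α ∈ M ↔ α ∈ N)) ∧
            ZModels N (Z ∪ (fun p : Σ n : ℕ, BF (n + 2) => replAx p.2) '' Φ) ∧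
            (ZModels M {acAx} → ZModels N {acAx}) := by
  obtain ⟨p, q, hpq⟩ := exists_vf
  obtain ⟨Ω, h7, hΩ, hpΩ, hqΩ⟩ := exists_seven p q
  have hGF : GF (M1 p q) := ⟨fun i => i.2.1⟩
  have hVF : VF (M1 p q) := hpq _ (fun i => i.2.2.1) (fun i => i.2.2.2)
  obtain ⟨F, hF⟩ := exists_F (M := M1 p q)
  refine ⟨Ω, F, h7, hΩ, fun M hc htr hZ Φ hΦ => ?_⟩
  have g : Good M := Good.of_Z htr (fun s hs => hZ s (Or.inl hs))
  let i : I1 p q := ⟨M, g, hZ _ (Or.inr hpΩ), hZ _ (Or.inr hqΩ)⟩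
  obtain ⟨G, hG⟩ := exists_gen g hc
  have hG' : Gen (M1 p q i) G := hG
  have gN : Good (ext M G) := ext_good (M := M1 p q) (i := i) hG'
  refine ⟨ext M G, sub_ext (M := M1 p q) (i := i) hG', ext_ne (M := M1 p q) (i := i) hG', ext_countable hc G, gN.tr, ext_ord (M := M1 p q) (i := i) hG', ?_, ?_⟩
  · rintro s (hs | ⟨φ, hφ, rfl⟩)
    · exact gN.models s hs
    · exact hF φ i G hG' (hΦ _ ⟨φ, hφ, rfl⟩)
  · intro h s hs
    have hs' : s = acAx := hs
    subst hs'
    refine (rz_acAx gN.tr gN.pair).2 (ext_ac (M := M1 p q) (i := i) hG' ((rz_acAx g.tr g.pair).1 (h _ rfl)))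

end CtmForcing
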